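/- Let R and S be connected graphs, each of order at least 3 and not isomorphic to P3. Then every 2-connected R-o-heavy and S-o-heavy graph is hamiltonian if and only if, up to interchanging R and S, R is isomorphic to the claw K_{1,3} and S is isomorphic to one of P4, P5, C3, Z1, Z2, B (the bull), N (the net), or W (the wounded). -/

import Mathlib

/-- A graph is 2-connected if it has at least 3 vertices and deleting any
single vertex leaves a connected graph. -/
def TwoConnected {V : Type*} [Fintype V] (G : SimpleGraph V) : Prop :=
  3 ≤ Fintype.card V ∧ ∀ v : V, (G.induce ({v}ᶜ : Set V)).Connected

/-- The claw `K_{1,3}`: center `0`, leaves `1, 2, 3`. -/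
def clawGraph : SimpleGraph (Fin 4) :=
  SimpleGraph.fromEdgeSet {s(0,1), s(0,2), s(0,3)}

/-- The triangle `C₃`. -/
def triangleGraph : SimpleGraph (Fin 3) :=
  SimpleGraph.fromEdgeSet {s(0,1), s(1,2), s(0,2)}

/-- `Z₁`: a triangle `0 1 2` with a pendant edge `2 3`. -/
def Z1 : SimpleGraph (Fin 4) :=
  SimpleGraph.fromEdgeSet {s(0,1), s(0,2), s(1,2), s(2,3)}

/-- `Z₂`: a triangle `0 1 2` with a pendant path `2 3 4` of length 2. -/
def Z2 : SimpleGraph (Fin 5) :=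
  SimpleGraph.fromEdgeSet {s(0,1), s(0,2), s(1,2), s(2,3), s(3,4)}

/-- The bull `B`: a triangle `0 1 2` with pendant edges `0 3` and `1 4`. -/
def bullGraph : SimpleGraph (Fin 5) :=
  SimpleGraph.fromEdgeSet {s(0,1), s(0,2), s(1,2), s(0,3), s(1,4)}

/-- The net `N`: a triangle `0 1 2` with pendant edges `0 3`, `1 4` and `2 5`. -/
def netGraph : SimpleGraph (Fin 6) :=
  SimpleGraph.fromEdgeSet {s(0,1), s(0,2), s(1,2), s(0,3), s(1,4), s(2,5)}

/-- The wounded `W`: a triangle `0 1 2` with a pendant edge `0 3` and a pendant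
path `1 4 5` of length 2. -/
def woundedGraph : SimpleGraph (Fin 6) :=
  SimpleGraph.fromEdgeSet {s(0,1), s(0,2), s(1,2), s(0,3), s(1,4), s(4,5)}

/-- `G` contains no induced subgraph isomorphic to `H`. -/
def IndFree {α β : Type*} (G : SimpleGraph α) (H : SimpleGraph β) : Prop :=
  ¬ ∃ s : Set α, Nonempty (H ≃g G.induce s)

/-- A graph `G` of order `n` is `H`-o-heavy if every induced subgraph of `G` isomorphic
to `H` contains two nonadjacent vertices whose degree sum in `G` is at least `n`. -/
def OHeavy {α V : Type*} [Fintype V] (G : SimpleGraph V) [DecidableRel G.Adj]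
    (H : SimpleGraph α) : Prop :=
  ∀ s : Set V, Nonempty (H ≃g G.induce s) →
    ∃ u v : V, u ∈ s ∧ v ∈ s ∧ u ≠ v ∧ ¬ G.Adj u v ∧
      Fintype.card V ≤ G.degree u + G.degree v

/-- `X` is isomorphic to one of `P₄, P₅, C₃, Z₁, Z₂, B, N, W`. -/
def IsOneOfLRWZ {χ : Type*} (X : SimpleGraph χ) : Prop :=
  Nonempty (X ≃g SimpleGraph.pathGraph 4) ∨ Nonempty (X ≃g SimpleGraph.pathGraph 5) ∨
  Nonempty (X ≃g triangleGraph) ∨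
  Nonempty (X ≃g Z1) ∨ Nonempty (X ≃g Z2) ∨ Nonempty (X ≃g bullGraph) ∨
  Nonempty (X ≃g netGraph) ∨ Nonempty (X ≃g woundedGraph)

namespace HeavyPairs

open SimpleGraph

variable {V : Type*}

/-- `m` is the multiset of vertices of some walk of `H` from `a` to `b`; when `m` has no
repetition this walk is a path. -/
def PathOn (H : SimpleGraph V) (m : Multiset V) (a b : V) : Prop :=
  ∃ l : List V, (l : Multiset V) = m ∧ l.IsChain H.Adj ∧ l.head? = some a ∧ l.getLast? = some b

/-- The list `A` is the interior of a walk of `H` from `b` to `c`. -/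
def Joins (H : SimpleGraph V) (A : List V) (b c : V) : Prop :=
  (b :: (A ++ [c])).IsChain H.Adj

/-- Every cycle of `H` has at most `c` vertices. -/
def CircLe (H : SimpleGraph V) (c : ℕ) : Prop :=
  ∀ m a b, PathOn H m a b → H.Adj b a → m.Nodup → m.card ≤ c

section PathOn

variable {H : SimpleGraph V} {m m' : Multiset V} {a b c d x y : V} {A : List V}

lemma PathOn.single (H : SimpleGraph V) (a : V) : PathOn H {a} a a :=
  ⟨[a], by simp⟩

lemma PathOn.append (h : PathOn H m a b) (hbc : H.Adj b c) (h' : PathOn H m' c d) :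
    PathOn H (m + m') a d := by
  obtain ⟨l, rfl, hl, hh, ht⟩ := h
  obtain ⟨l', rfl, hl', hh', ht'⟩ := h'
  refine ⟨l ++ l', by simp, hl.append hl' ?_, by simp [hh], by simp [ht']⟩
  simp [hh', ht, hbc]

lemma PathOn.snoc (h : PathOn H m a b) (hbc : H.Adj b c) : PathOn H (m + {c}) a c :=
  h.append hbc (.single H c)

lemma PathOn.symm (h : PathOn H m a b) : PathOn H m b a := by
  obtain ⟨l, rfl, hl, hh, ht⟩ := h
  refine ⟨l.reverse, by simp, ?_, by simp [ht], by simp [hh]⟩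
  rw [List.isChain_reverse]
  exact hl.imp fun _ _ h => h.symm

lemma PathOn.mono {H' : SimpleGraph V} (hH : H ≤ H') (h : PathOn H m a b) : PathOn H' m a b := by
  obtain ⟨l, rfl, hl, hh, ht⟩ := h
  exact ⟨l, rfl, hl.imp fun _ _ h => hH h, hh, ht⟩

lemma PathOn.left_mem (h : PathOn H m a b) : a ∈ m := by
  obtain ⟨l, rfl, -, hh, -⟩ := h
  exact List.mem_of_mem_head? hh

lemma PathOn.right_mem (h : PathOn H m a b) : b ∈ m := h.symm.left_mem

lemma Joins.symm (h : Joins H A b c) : Joins H A.reverse c b := by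
  have : (b :: (A ++ [c])).reverse.IsChain H.Adj := by
    rw [List.isChain_reverse]
    exact List.IsChain.imp (fun _ _ h => h.symm) h
  simpa [Joins] using this

lemma Joins.mono {H' : SimpleGraph V} (hH : H ≤ H') (h : Joins H A b c) : Joins H' A b c :=
  List.IsChain.imp (fun _ _ h => hH h) h

lemma joins_nil : Joins H [] b c ↔ H.Adj b c := by
  simp [Joins]

lemma joins_cons : Joins H (x :: A) b c ↔ H.Adj b x ∧ Joins H A x c := by
  simp [Joins]

lemma joins_append {B : List V} :
    Joins H (A ++ x :: B) b c ↔ Joins H A b x ∧ Joins H B x c := by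
  induction A generalizing b with
  | nil => simp [joins_nil, joins_cons]
  | cons y A ih => simp [joins_cons, ih, and_assoc]

lemma PathOn.join (h : PathOn H m x b) (hA : Joins H A b c) (h' : PathOn H m' c y) :
    PathOn H (m + A + m') x y := by
  induction A generalizing b m with
  | nil => simpa using h.append (joins_nil.1 hA) h'
  | cons z A ih =>
    obtain ⟨hz, hA⟩ := joins_cons.1 hA
    have := ih (h.snoc hz) hA
    rwa [add_assoc m {z}, Multiset.singleton_add, Multiset.cons_coe] at this

lemma Joins.pathOn (hA : Joins H A b c) : PathOn H ({b} + A + {c}) b c :=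
  (PathOn.single H b).join hA (.single H c)

lemma Joins.pathOn_left (hA : Joins H (A ++ [x]) b c) : PathOn H ({b} + A + {x}) b x :=
  (joins_append.1 hA).1.pathOn

lemma PathOn.extend (h : PathOn H m x b) (hA : Joins H A b c) : PathOn H (m + A + {c}) x c :=
  h.join hA (.single H c)

end PathOn

section Counting

lemma countP_add_countP_le (X Y : V → Bool) (l : List V)
    (h : l.IsChain fun u w => ¬ (X u ∧ Y w)) :
    l.countP X + l.countP Y ≤ l.length + (if ∃ y ∈ l.head?, Y y then 1 else 0) := by
  induction l with
  | nil => simp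
  | cons u l ih =>
    have ih := ih h.tail
    rcases l with _ | ⟨w, l⟩
    · cases hX : X u <;> cases hY : Y u <;> simp [hX, hY]
    · have huw := (List.isChain_cons_cons.1 h).1
      simp only [List.countP_cons, List.head?_cons, Option.mem_def, Option.some.injEq,
        exists_eq_left', List.length_cons] at ih ⊢
      cases hX : X u <;> cases hY : Y u <;> cases hw : Y w <;>
        simp only [hX, hw, Bool.false_eq_true, if_true, if_false, and_self,
          not_true] at ih huw ⊢ <;>
        omega

/-- If each element satisfying `X` is followed by at least `j` elements violating `Y`, then few
elements satisfy `X` or `Y`. -/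
lemma countP_add_countP_add_le (X Y : V → Bool) (j : ℕ) (hj : 1 ≤ j) (l : List V)
    (hX : ∃ u ∈ l, X u)
    (hend : ∀ S u M, l = S ++ u :: M → X u → j ≤ M.length)
    (hgap : ∀ S u M w T, l = S ++ u :: (M ++ w :: T) → X u → Y w → j ≤ M.length) :
    l.countP X + l.countP Y + j ≤ l.length + 1 := by
  obtain ⟨S, u, M, rfl, hu, hM⟩ : ∃ S u M, l = S ++ u :: M ∧ X u ∧ ∀ x ∈ M, ¬ X x := by
    clear hend hgap
    induction l with
    | nil => simp at hX
    | cons z l ih =>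
      by_cases h : ∃ u ∈ l, X u
      · obtain ⟨S, u, M, rfl, h1, h2⟩ := ih h
        exact ⟨z :: S, u, M, by simp, h1, h2⟩
      · refine ⟨[], z, l, rfl, ?_, by simpa using h⟩
        obtain ⟨u, hu, hXu⟩ := hX
        rcases List.mem_cons.1 hu with rfl | hu
        · exact hXu
        · exact absurd ⟨u, hu, hXu⟩ h
  have hjM := hend S u M rfl hu
  have hM0 : M.countP X = 0 := List.countP_eq_zero.2 hM
  have hMY : M.countP Y + j ≤ M.length := by
    have h1 : (M.take j).countP Y = 0 := by
      refine List.countP_eq_zero.2 fun w hw hYw => ?_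
      obtain ⟨s, t, hst⟩ := List.append_of_mem hw
      have hlen : s.length < j := by
        have := congrArg List.length hst
        simp at this; omega
      have hM' : M = s ++ w :: (t ++ M.drop j) := by
        rw [← List.cons_append, ← List.append_assoc, ← hst, List.take_append_drop]
      have := hgap S u s w (t ++ M.drop j) (congrArg (S ++ u :: ·) hM') hu hYw
      omega
    have h2 := List.countP_le_length (p := Y) (l := M.drop j)
    rw [← List.take_append_drop j M, List.countP_append, h1]
    simp at h2 ⊢; omega
  have hS := countP_add_countP_le X Y (S ++ [u]) (by
    rw [List.isChain_iff_forall_rel_of_append_cons_cons]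
    rintro x y l₁ l₂ h ⟨h1, h2⟩
    have := hgap l₁ x [] y (l₂ ++ M) (by
      have : S ++ u :: M = (S ++ [u]) ++ M := by simp
      rw [this, h]; simp) h1 h2
    simp at this; omega)
  have : (if ∃ y ∈ (S ++ [u]).head?, Y y then 1 else 0) ≤ 1 := by split_ifs <;> simp
  simp only [List.countP_append, List.countP_cons, List.length_append, List.length_cons,
    hM0, List.countP_nil, List.length_nil] at *
  omega

variable [Fintype V] [DecidableEq V]

lemma degree_eq_countP_add (G : SimpleGraph V) [DecidableRel G.Adj] (u : V) {l : List V}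
    (hl : l.Nodup) :
    G.degree u = l.countP (fun x => G.Adj u x) +
      (Finset.univ.filter fun x => x ∉ l ∧ G.Adj u x).card := by
  rw [← G.card_neighborFinset_eq_degree, neighborFinset_eq_filter,
    ← Finset.card_filter_add_card_filter_not (s := Finset.univ.filter (G.Adj u)) (· ∈ l)]
  congr 1
  · rw [List.countP_eq_length_filter, ← List.toFinset_card_of_nodup (hl.filter _)]
    congr 1
    ext x; simp [and_comm]
  · congr 1
    ext x; simp [and_comm]

end Counting

section Closure

variable {V : Type*}

lemma isChain_of_isChain_sup_edge {K : SimpleGraph V} {u v : V} {l : List V}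
    (hl : l.IsChain (K ⊔ edge u v).Adj) (huv : u ∉ l ∨ v ∉ l) : l.IsChain K.Adj := by
  rw [List.isChain_iff_forall_rel_of_append_cons_cons] at hl ⊢
  intro x y s t h
  have := hl h
  simp only [sup_adj, edge_adj] at this
  subst h
  simp only [List.mem_append, List.mem_cons, not_or] at huv
  rcases this with h | ⟨⟨rfl, rfl⟩ | ⟨rfl, rfl⟩, -⟩
  · exact h
  · tauto
  · tauto

lemma cycle_or_pathOn_of_sup_edge {K : SimpleGraph V} {u v a b : V} {m : Multiset V}
    (h : PathOn (K ⊔ edge u v) m a b) (hba : (K ⊔ edge u v).Adj b a) (hm : m.Nodup)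
    (hcard : 3 ≤ m.card) : (PathOn K m a b ∧ K.Adj b a) ∨ PathOn K m u v := by
  obtain ⟨l, rfl, hl, hh, ht⟩ := h
  rw [Multiset.coe_nodup] at hm
  rw [Multiset.coe_card] at hcard
  by_cases hK : l.IsChain K.Adj
  · simp only [sup_adj, edge_adj] at hba
    rcases hba with h | ⟨⟨rfl, rfl⟩ | ⟨rfl, rfl⟩, -⟩
    · exact .inl ⟨⟨l, rfl, hK, hh, ht⟩, h⟩
    · exact .inr (PathOn.symm ⟨l, rfl, hK, hh, ht⟩)
    · exact .inr ⟨l, rfl, hK, hh, ht⟩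
  · rw [List.isChain_iff_forall_rel_of_append_cons_cons] at hK
    push Not at hK
    obtain ⟨x, y, s, t, rfl, hxy⟩ := hK
    have hxy' : (K ⊔ edge u v).Adj x y :=
      List.isChain_iff_forall_rel_of_append_cons_cons.1 hl (rfl : _ = s ++ x :: y :: t)
    have hxy'' : (x = u ∧ y = v) ∨ (x = v ∧ y = u) := by
      simp only [sup_adj, edge_adj, hxy, false_or] at hxy'
      tauto
    have e : s ++ x :: y :: t = (s ++ [x]) ++ y :: t := by simp
    have hd : x ∉ y :: t ∧ y ∉ s ++ [x] := by
      rw [e, List.nodup_append] at hm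
      exact ⟨fun h => hm.2.2 x (by simp) x h rfl, fun h => hm.2.2 y h y (by simp) rfl⟩
    rw [e, List.isChain_append] at hl
    have h1 : (s ++ [x]).IsChain K.Adj := isChain_of_isChain_sup_edge hl.1 (by
      rcases hxy'' with ⟨rfl, rfl⟩ | ⟨rfl, rfl⟩ <;> tauto)
    have h2 : (y :: t).IsChain K.Adj := isChain_of_isChain_sup_edge hl.2.1 (by
      rcases hxy'' with ⟨rfl, rfl⟩ | ⟨rfl, rfl⟩ <;> tauto)
    have hs : (s ++ [x]).head? = some a := by
      rw [e, List.head?_append] at hh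
      cases s <;> simpa using hh
    have ht' : (y :: t).getLast? = some b := by
      rw [e, List.getLast?_append] at ht
      cases hq : (y :: t).getLast? with
      | none => simp at hq
      | some z => simpa [hq] using ht
    have hba' : K.Adj b a := by
      simp only [sup_adj, edge_adj] at hba
      rcases hba with h | hba
      · exact h
      · exfalso
        have ha : a ∈ s ++ [x] := List.mem_of_mem_head? hs
        have hb : b ∈ y :: t := List.mem_of_getLast? ht'
        have hlast : b = y → t = [] := by
          rintro rfl
          cases t with
          | nil => rfl
          | cons z t =>
            have : b ∈ z :: t := List.mem_of_getLast? (by simpa using ht')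
            exact absurd this (List.nodup_cons.1 (List.nodup_cons.1
              (List.nodup_append.1 hm).2.1).2).1
        have hfirst : a = x → s = [] := by
          rintro rfl
          cases s with
          | nil => rfl
          | cons z s =>
            simp at hs
            simp_all
        have : b = y ∧ a = x := by
          rcases hba.1 with ⟨rfl, rfl⟩ | ⟨rfl, rfl⟩ <;>
          rcases hxy'' with ⟨rfl, rfl⟩ | ⟨rfl, rfl⟩ <;> tauto
        have h1 := hlast this.1
        have h2 := hfirst this.2
        simp [h1, h2] at hcard
    have key : PathOn K ((s ++ x :: y :: t : List V) : Multiset V) y x := by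
      have := PathOn.append (a := y) (d := x) ⟨y :: t, rfl, h2, by simp, ht'⟩ hba'
        ⟨s ++ [x], rfl, h1, hs, by simp⟩
      convert this using 1
      rw [e, Multiset.coe_add]
      exact Multiset.coe_eq_coe.2 List.perm_append_comm
    rcases hxy'' with ⟨rfl, rfl⟩ | ⟨rfl, rfl⟩
    · exact .inr key.symm
    · exact .inr key

variable [Fintype V]

/-- Adding an edge between every pair of distinct vertices whose degree sum is at least the
order of the graph. -/
def heavyClosure (G : SimpleGraph V) [DecidableRel G.Adj] : SimpleGraph V where
  Adj u v := u ≠ v ∧ (G.Adj u v ∨ Fintype.card V ≤ G.degree u + G.degree v)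
  symm := ⟨fun u v h => ⟨h.1.symm, h.2.imp (·.symm) (by rw [add_comm]; exact id)⟩⟩
  loopless := ⟨fun _ h => h.1 rfl⟩

variable {G : SimpleGraph V} [DecidableRel G.Adj]

lemma le_heavyClosure : G ≤ heavyClosure G := fun _ _ h => ⟨h.ne, .inl h⟩

/-- Two nonadjacent vertices joined by a Hamilton path of a longest possible vertex set do not
have a large degree sum. -/
lemma card_le_of_pathOn_of_heavy {K : SimpleGraph V} {c : ℕ} (hGK : G ≤ K) (hK : CircLe K c)
    {m : Multiset V} {u v : V} (h : PathOn K m u v) (hm : m.Nodup)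
    (hnadj : ¬ K.Adj u v) (hdeg : Fintype.card V ≤ G.degree u + G.degree v) : m.card ≤ c := by
  classical
  by_contra! hc
  obtain ⟨l, rfl, hl, hh, ht⟩ := h
  have hm' := hm
  rw [Multiset.coe_nodup] at hm
  rw [Multiset.coe_card] at hc
  obtain ⟨l0, rfl⟩ : ∃ l0, l = l0 ++ [v] := by
    rw [List.getLast?_eq_some_iff] at ht; exact ht
  have hout : ∀ w, w ∉ l0 ++ [v] → G.Adj u w → ¬ G.Adj v w := by
    intro w hw hu hv
    have := hK _ u w (PathOn.snoc ⟨_, rfl, hl, hh, ht⟩ (hGK hv)) (hGK hu).symm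
      (by rw [Multiset.add_comm, Multiset.singleton_add, Multiset.nodup_cons]
          exact ⟨by simpa using hw, hm'⟩)
    simp at this hc
    omega
  have hcross : (l0 : List V).IsChain
      fun x y => ¬ (decide (G.Adj v x) = true ∧ decide (G.Adj u y) = true) := by
    rw [List.isChain_iff_forall_rel_of_append_cons_cons]
    rintro x y s t rfl ⟨h1, h2⟩
    simp only [decide_eq_true_eq] at h1 h2
    have e : (s ++ x :: y :: t) ++ [v] = (s ++ [x]) ++ y :: (t ++ [v]) := by simp
    rw [e, List.isChain_append] at hl
    have p1 : PathOn K ((s ++ [x] : List V) : Multiset V) u x :=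
      ⟨_, rfl, hl.1, by rw [e] at hh; cases s <;> simpa using hh, by simp⟩
    have p2 : PathOn K ((y :: (t ++ [v]) : List V) : Multiset V) y v :=
      ⟨_, rfl, hl.2.1, by simp, by
        rw [← List.cons_append, List.getLast?_append]; simp⟩
    have := hK _ _ _ (p1.append (hGK h1).symm p2.symm) (hGK h2).symm (by
      rw [e] at hm'
      simpa using hm')
    simp at this hc
    omega
  have hcount := countP_add_countP_le _ _ _ hcross
  have hif : ¬ ∃ y ∈ l0.head?, decide (G.Adj u y) = true := by
    rintro ⟨y, hy, hadj⟩
    rw [List.head?_append, hy] at hh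
    simp at hh hadj
    exact hadj.ne hh.symm
  rw [if_neg hif] at hcount
  have hu := degree_eq_countP_add G u hm
  have hv := degree_eq_countP_add G v hm
  have hA : ¬ G.Adj u v := fun h => hnadj (hGK h)
  simp only [List.countP_append, List.countP_cons, List.countP_nil, hA, G.irrefl, decide_false,
    Bool.false_eq_true, if_false, add_zero] at hu hv
  have hsum : (Finset.univ.filter fun x => x ∉ l0 ++ [v] ∧ G.Adj u x).card +
      (Finset.univ.filter fun x => x ∉ l0 ++ [v] ∧ G.Adj v x).card + (l0 ++ [v]).length
      ≤ Fintype.card V := by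
    rw [← List.toFinset_card_of_nodup hm, ← Finset.card_union_of_disjoint,
      ← Finset.card_union_of_disjoint]
    · exact Finset.card_le_univ _
    · rw [Finset.disjoint_left]
      intro x hx
      simp only [Finset.mem_union, Finset.mem_filter] at hx
      rw [List.mem_toFinset]
      tauto
    · rw [Finset.disjoint_left]
      intro x hx
      simp only [Finset.mem_filter] at hx ⊢
      have := hout x
      tauto
  simp only [List.length_append, List.length_singleton] at hsum
  omega

lemma circLe_heavyClosure {c : ℕ} (hc : 2 ≤ c) (h : CircLe G c) : CircLe (heavyClosure G) c := by
  classical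
  obtain ⟨K, hGK, hK⟩ := (Set.toFinite {K : SimpleGraph V | K ≤ heavyClosure G ∧
    CircLe K c}).exists_le_maximal (a := G) ⟨le_heavyClosure, h⟩
  suffices K = heavyClosure G by rw [← this]; exact hK.1.2
  by_contra hne
  obtain ⟨u, v, huv, hnuv⟩ : ∃ u v, (heavyClosure G).Adj u v ∧ ¬ K.Adj u v := by
    by_contra! hcon
    exact hne (le_antisymm hK.1.1 fun u v => hcon u v)
  have hmem : K ⊔ edge u v ≤ heavyClosure G ∧ CircLe (K ⊔ edge u v) c := by
    refine ⟨sup_le hK.1.1 ?_, ?_⟩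
    · exact (edge_le_iff _).2 (.inr huv)
    · intro m a b hp hba hm
      by_contra! hcm
      rcases cycle_or_pathOn_of_sup_edge hp hba hm (by omega) with ⟨h1, h2⟩ | h1
      · exact absurd (hK.1.2 m a b h1 h2 hm) (by omega)
      · exact absurd (card_le_of_pathOn_of_heavy hGK hK.1.2 h1 hm hnuv
          (huv.2.resolve_left fun h => hnuv (hGK h))) (by omega)
  have := hK.2 hmem le_sup_left
  exact hnuv (this (by simp [edge_adj, huv.1]))

end Closure

section Composed

variable {V : Type*}

/-- The multiset `I` splits into a path from `x` to `y` and a path from `u` to `w`. -/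
def Two (H : SimpleGraph V) (I : Multiset V) (x y u w : V) : Prop :=
  ∃ m₁ m₂, m₁ + m₂ = I ∧ PathOn H m₁ x y ∧ PathOn H m₂ u w

section Two

variable {H : SimpleGraph V} {I : Multiset V} {x y u w z : V}

lemma Two.symm_right (h : Two H I x y u w) : Two H I x y w u :=
  let ⟨m₁, m₂, h, h₁, h₂⟩ := h
  ⟨m₁, m₂, h, h₁, h₂.symm⟩

lemma Two.snoc_left (h : Two H I x y u w) (hz : H.Adj y z) : Two H (I + {z}) x z u w := by
  obtain ⟨m₁, m₂, rfl, h₁, h₂⟩ := h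
  exact ⟨_, _, by rw [add_right_comm], h₁.snoc hz, h₂⟩

lemma Two.snoc_right (h : Two H I x y u w) (hz : H.Adj w z) : Two H (I + {z}) x y u z := by
  obtain ⟨m₁, m₂, rfl, h₁, h₂⟩ := h
  exact ⟨_, _, by rw [add_assoc], h₁, h₂.snoc hz⟩

lemma Two.cons_right (h : Two H I x y u w) (hz : H.Adj u z) : Two H (I + {z}) x y z w :=
  (h.symm_right.snoc_right hz).symm_right

lemma Two.through (h : Two H I x y u w) (hyz : H.Adj y z) (hzu : H.Adj z u) :
    PathOn H (I + {z}) x w := by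
  obtain ⟨m₁, m₂, rfl, h₁, h₂⟩ := h
  have := (h₁.snoc hyz).append hzu h₂
  rwa [add_right_comm] at this

lemma PathOn.two (h : PathOn H I x y) (z : V) : Two H (I + {z}) x y z z :=
  ⟨_, _, rfl, h, .single H z⟩

end Two

/-- An interval of a cycle of `G` with ends `a` and `b` and an interior vertex `p`, whose vertices
can be traversed in many ways along edges of `H`. -/
structure Comp (G H : SimpleGraph V) (I : Multiset V) (p a b : V) : Prop where
  path : PathOn G I a b
  mem : p ∈ I
  ne_left : p ≠ a
  ne_right : p ≠ b
  ne : a ≠ b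
  nbr : ∀ w, ∃ y ∈ I, G.Adj p y ∧ y ≠ w
  to_left : PathOn H I p a
  to_right : PathOn H I p b
  left_left : Two H I p b a a
  right_right : Two H I p a b b
  inner : ∀ s ∈ I, s ≠ a → s ≠ b → (Two H I p b s a ∧ Two H I p a s b) ∨ Two H I p s b a
  split : ∀ s ∈ I, s ≠ p → Two H I p b s a ∨ Two H I p a s b

namespace Comp

variable {G H : SimpleGraph V} {I : Multiset V} {p a b z v t : V}

lemma mirror (h : Comp G H I p a b) : Comp G H I p b a where
  path := h.path.symm
  mem := h.mem
  ne_left := h.ne_right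
  ne_right := h.ne_left
  ne := h.ne.symm
  nbr := h.nbr
  to_left := h.to_right
  to_right := h.to_left
  left_left := h.right_right
  right_right := h.left_left
  inner s hs hb ha := (h.inner s hs ha hb).imp And.symm Two.symm_right
  split s hs hp := (h.split s hs hp).symm

lemma base (hGH : G ≤ H) (hpa : G.Adj a p) (hpb : G.Adj p b) (hab : H.Adj a b) :
    Comp G H ({a} + {p} + {b}) p a b where
  path := ((PathOn.single G a).snoc hpa).snoc hpb
  mem := by simp
  ne_left := hpa.ne.symm
  ne_right := hpb.ne
  ne := hab.ne
  nbr w := by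
    by_cases h : a = w
    · exact ⟨b, by simp, hpb, h ▸ hab.ne.symm⟩
    · exact ⟨a, by simp, hpa.symm, h⟩
  to_left := by
    have := ((PathOn.single H p).snoc (hGH hpb)).snoc hab.symm
    rwa [add_comm, ← add_assoc] at this
  to_right := by
    have := ((PathOn.single H p).snoc (hGH hpa.symm)).snoc hab
    rwa [add_comm ({p} : Multiset V)] at this
  left_left := by
    have := ((PathOn.single H p).snoc (hGH hpb)).two a
    rwa [add_comm, ← add_assoc] at this
  right_right := by
    have := ((PathOn.single H p).snoc (hGH hpa.symm)).two b
    rwa [add_comm ({p} : Multiset V)] at this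
  inner s hs hsa hsb := by
    obtain rfl : s = p := by simpa [hsa, hsb] using hs
    exact .inr ⟨{s}, {a} + {b}, by rw [← add_assoc, add_comm ({s} : Multiset V)], .single H s,
      ((PathOn.single H a).snoc hab).symm⟩
  split s hs hsp := by
    rcases (by simpa [hsp] using hs : s = a ∨ s = b) with rfl | rfl
    · left
      have := ((PathOn.single H p).snoc (hGH hpb)).two s
      rwa [add_comm, ← add_assoc] at this
    · right
      have := ((PathOn.single H p).snoc (hGH hpa.symm)).two s
      rwa [add_comm ({p} : Multiset V)] at this

lemma extend (h : Comp G H I p a b) (hGH : G ≤ H) (hz : z ∉ I) (hbz : G.Adj b z)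
    (hzt : H.Adj z t) (ht : t ∈ I) (htb : t ≠ b) : Comp G H (I + {z}) p a z := by
  have hbz' := hGH hbz
  have key : Two H I p b t a ∨ Two H I p t b a := by
    by_cases hta : t = a
    · subst hta; exact .inl h.left_left
    · exact (h.inner t ht hta htb).imp And.left id
  have h_right : Two H (I + {z}) p a z z := h.to_left.two z
  exact {
    path := h.path.snoc hbz
    mem := Multiset.mem_add.2 (.inl h.mem)
    ne_left := h.ne_left
    ne_right := fun e => hz (e ▸ h.mem)
    ne := fun e => hz (e ▸ h.path.left_mem)
    nbr := fun w =>
      let ⟨y, hy, h'⟩ := h.nbr w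
      ⟨y, Multiset.mem_add.2 (.inl hy), h'⟩
    to_left := by
      rcases key with h' | h'
      · exact h'.through hbz' hzt
      · exact h'.through hzt.symm hbz'.symm
    to_right := h.to_right.snoc hbz'
    left_left := h.left_left.snoc_left hbz'
    right_right := h_right
    inner := by
      intro s hs hsa hsz
      have hs : s ∈ I := by simpa [hsz] using hs
      by_cases hsb : s = b
      · subst hsb
        rcases key with h' | h'
        · exact .inr (h'.cons_right hzt.symm)
        · exact .inl ⟨h'.snoc_left hzt.symm, h.right_right.snoc_right hbz'⟩
      · rcases h.inner s hs hsa hsb with ⟨h₁, h₂⟩ | h'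
        · exact .inl ⟨h₁.snoc_left hbz', h₂.snoc_right hbz'⟩
        · exact .inr (h'.cons_right hbz')
    split := by
      intro s hs hsp
      by_cases hsz : s = z
      · subst hsz; exact .inr h_right
      · have hs : s ∈ I := by simpa [hsz] using hs
        exact (h.split s hs hsp).imp (·.snoc_left hbz') (·.snoc_right hbz') }

lemma extend_both (h : Comp G H I p a b) (hGH : G ≤ H) (hz : z ∉ I) (hv : v ∉ I)
    (hbz : G.Adj b z) (hav : G.Adj a v) (hzv : H.Adj z v) : Comp G H (I + {z} + {v}) p v z := by
  have hbz' := hGH hbz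
  have hav' := hGH hav
  have h₁ : Two H (I + {z} + {v}) p v z z := by
    rw [add_right_comm]; exact (h.to_left.snoc hav').two z
  have h₂ : Two H (I + {z} + {v}) p z v v := (h.to_right.snoc hbz').two v
  exact {
    path := ((h.path.snoc hbz).symm.snoc hav).symm
    mem := by simp [h.mem]
    ne_left := fun e => hv (e ▸ h.mem)
    ne_right := fun e => hz (e ▸ h.mem)
    ne := hzv.ne.symm
    nbr := fun w =>
      let ⟨y, hy, h'⟩ := h.nbr w
      ⟨y, by simp [hy], h'⟩
    to_left := (h.to_right.snoc hbz').snoc hzv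
    to_right := by
      have := (h.to_left.snoc hav').snoc hzv.symm
      rwa [add_right_comm] at this
    left_left := h₂
    right_right := h₁
    inner := by
      intro s hs hsv hsz
      have hs : s ∈ I := by simpa [hsz, hsv] using hs
      have hvz : PathOn H ({z} + {v}) z v := (PathOn.single H z).snoc hzv
      by_cases hsb : s = b
      · subst hsb
        exact .inr ⟨_, _, by rw [add_assoc], h.to_right, hvz⟩
      by_cases hsa : s = a
      · subst hsa
        exact .inr ⟨_, _, by rw [add_assoc], h.to_left, hvz⟩
      rcases h.inner s hs hsa hsb with ⟨h₁, h₂⟩ | h'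
      · exact .inl ⟨(h₁.snoc_left hbz').snoc_right hav', (h₂.snoc_right hbz').snoc_left hav'⟩
      · exact .inr ((h'.cons_right hbz').snoc_right hav')
    split := by
      intro s hs hsp
      by_cases hsz : s = z
      · subst hsz; exact .inr h₁
      by_cases hsv : s = v
      · subst hsv; exact .inl h₂
      have hs : s ∈ I := by simpa [hsz, hsv] using hs
      exact (h.split s hs hsp).imp (fun h => (h.snoc_left hbz').snoc_right hav')
        (fun h => (h.snoc_right hbz').snoc_left hav') }

end Comp

/-- A cycle with vertex set `C` of `G`, which consists of two composed intervals `I` around `p`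
and `J` around `q` and of the paths with interiors `A` and `B` between them. -/
structure Frame (G H : SimpleGraph V) (C : Multiset V) (p q : V) (I J : Multiset V)
    (a b c d : V) (A B : List V) : Prop where
  left : Comp G H I p a b
  right : Comp G H J q c d
  joins_left : Joins G A b c
  joins_right : Joins G B d a
  sum : I + J + A + B = C

namespace Frame

variable {G H : SimpleGraph V} {C I J : Multiset V} {p q a b c d s t z v : V} {A B : List V}

lemma mirror (h : Frame G H C p q I J a b c d A B) :
    Frame G H C p q I J b a d c B.reverse A.reverse where
  left := h.left.mirror
  right := h.right.mirror
  joins_left := h.joins_right.symm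
  joins_right := h.joins_left.symm
  sum := by
    rw [← h.sum, Multiset.coe_reverse, Multiset.coe_reverse, add_right_comm]

lemma swap (h : Frame G H C p q I J a b c d A B) : Frame G H C q p J I c d a b B A where
  left := h.right
  right := h.left
  joins_left := h.joins_right
  joins_right := h.joins_left
  sum := by rw [← h.sum, add_comm J I, add_right_comm]

lemma left_ne_nil (h : Frame G H C p q I J a b c d A B) (hGH : G ≤ H)
    (hno : ¬ PathOn H C p q) : A ≠ [] := by
  rintro rfl
  refine hno ?_
  have := h.left.to_left.join (h.joins_right.mono hGH).symm h.right.to_right.symm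
  rw [← h.sum]
  convert this using 1
  simp [add_right_comm]

lemma right_ne_nil (h : Frame G H C p q I J a b c d A B) (hGH : G ≤ H)
    (hno : ¬ PathOn H C p q) : B ≠ [] := by
  simpa using h.mirror.left_ne_nil hGH hno

lemma false_of_split_split (h : Frame G H C p q I J a b c d A B) (hGH : G ≤ H)
    (hno : ¬ PathOn H C p q) (hst : H.Adj s t) (h₁ : Two H I p b s a) (h₂ : Two H J q d t c) :
    False := by
  obtain ⟨m₁, m₂, rfl, h₁, h₁'⟩ := h₁
  obtain ⟨m₃, m₄, rfl, h₂, h₂'⟩ := h₂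
  have := ((h₁.join (h.joins_left.mono hGH) h₂'.symm).append hst.symm h₁').join
    (h.joins_right.mono hGH).symm h₂.symm
  refine hno ?_
  rw [← h.sum]
  rw [Multiset.coe_reverse] at this
  convert this using 1
  abel

lemma false_of_split_inner (h : Frame G H C p q I J a b c d A B) (hGH : G ≤ H)
    (hno : ¬ PathOn H C p q) (hst : H.Adj s t) (h₁ : Two H I p b s a) (h₂ : Two H J q t d c) :
    False := by
  obtain ⟨m₁, m₂, rfl, h₁, h₁'⟩ := h₁
  obtain ⟨m₃, m₄, rfl, h₂, h₂'⟩ := h₂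
  have := ((h₁.join (h.joins_left.mono hGH) h₂'.symm).join (h.joins_right.mono hGH)
    h₁'.symm).append hst h₂.symm
  refine hno ?_
  rw [← h.sum]
  convert this using 1
  abel

lemma eq_of_adj_of_inner (h : Frame G H C p q I J a b c d A B) (hGH : G ≤ H)
    (hno : ¬ PathOn H C p q) (hs : s ∈ I) (ht : t ∈ J) (hst : H.Adj s t) (hsa : s ≠ a)
    (hsb : s ≠ b) : s = p ∧ t = q := by
  have h' := h.mirror
  have h'' := h.swap.mirror
  have hno' : ¬ PathOn H C q p := fun h => hno h.symm
  rcases h.left.inner s hs hsa hsb with ⟨h₁, h₂⟩ | h₁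
  · exfalso
    by_cases htq : t = q
    · have htc : t ≠ c := htq ▸ h.right.ne_left
      have htd : t ≠ d := htq ▸ h.right.ne_right
      rcases h.right.inner t ht htc htd with h₃ | h₃
      · exact h.false_of_split_split hGH hno hst h₁ h₃.1
      · exact h.false_of_split_inner hGH hno hst h₁ h₃
    · rcases h.right.split t ht htq with h₃ | h₃
      · exact h.false_of_split_split hGH hno hst h₁ h₃
      · exact h'.false_of_split_split hGH hno hst h₂ h₃
  · have htq : t = q := by
      by_contra htq
      rcases h.right.split t ht htq with h₃ | h₃
      · exact h.swap.false_of_split_inner hGH hno' hst.symm h₃ h₁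
      · exact h''.false_of_split_inner hGH hno' hst.symm h₃ h₁.symm_right
    refine ⟨?_, htq⟩
    by_contra hsp
    have htc : t ≠ c := htq ▸ h.right.ne_left
    have htd : t ≠ d := htq ▸ h.right.ne_right
    rcases h.right.inner t ht htc htd with h₃ | h₃
    · exact h.swap.false_of_split_inner hGH hno' hst.symm h₃.1 h₁
    · rcases h.left.split s hs hsp with h₄ | h₄
      · exact h.false_of_split_inner hGH hno hst h₄ h₃
      · exact h'.false_of_split_inner hGH hno hst h₄ h₃.symm_right

lemma eq_of_adj (h : Frame G H C p q I J a b c d A B) (hGH : G ≤ H)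
    (hno : ¬ PathOn H C p q) (hs : s ∈ I) (ht : t ∈ J) (hst : H.Adj s t) :
    (s = p ∧ t = q) ∨ (s = b ∧ t = c) ∨ (s = a ∧ t = d) := by
  have hno' : ¬ PathOn H C q p := fun h => hno h.symm
  by_cases h1 : s ≠ a ∧ s ≠ b
  · exact .inl (h.eq_of_adj_of_inner hGH hno hs ht hst h1.1 h1.2)
  by_cases h2 : t ≠ c ∧ t ≠ d
  · exact .inl (h.swap.eq_of_adj_of_inner hGH hno' ht hs hst.symm h2.1 h2.2).symm
  have h1 : s = a ∨ s = b := by tauto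
  have h2 : t = c ∨ t = d := by tauto
  rcases h1 with rfl | rfl <;> rcases h2 with rfl | rfl
  · exact (h.false_of_split_split hGH hno hst h.left.left_left h.right.left_left).elim
  · tauto
  · tauto
  · exact (h.mirror.false_of_split_split hGH hno hst h.left.right_right
      h.right.right_right).elim

lemma eq_of_adj_left (h : Frame G H C p q I J a b c d (z :: A) B) (hGH : G ≤ H)
    (hno : ¬ PathOn H C p q) (ht : t ∈ J) (hzt : H.Adj z t) : t = c := by
  by_contra htc
  have key : Two H J q c t d ∨ Two H J q t d c := by
    by_cases htd : t = d
    · subst htd; exact .inl h.right.right_right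
    · exact (h.right.inner t ht htc htd).imp And.right id
  have hA := (joins_cons.1 (h.joins_left.mono hGH)).2
  refine hno ?_
  rw [← h.sum, ← Multiset.cons_coe, ← Multiset.singleton_add]
  rcases key with h₁ | h₁ <;> obtain ⟨m₁, m₂, rfl, h₁, h₂⟩ := h₁
  · have := ((h.left.to_left.join (h.joins_right.mono hGH).symm h₂.symm).snoc hzt.symm).join
      hA h₁.symm
    rw [Multiset.coe_reverse] at this
    convert this using 1
    abel
  · have := ((h.left.to_left.join (h.joins_right.mono hGH).symm h₂).extend hA.symm).append hzt
      h₁.symm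
    rw [Multiset.coe_reverse, Multiset.coe_reverse] at this
    convert this using 1
    abel

lemma pathOn_of_mem (h : Frame G H C p q I J a b c d A B) (hGH : G ≤ H) (hs : s ∈ I)
    (hsp : s ≠ p) : PathOn H C p s := by
  rw [← h.sum]
  rcases h.left.split s hs hsp with h₁ | h₁ <;> obtain ⟨m₁, m₂, rfl, h₁, h₂⟩ := h₁
  · have := (h₁.join (h.joins_left.mono hGH) (h.right.path.mono hGH)).join
      (h.joins_right.mono hGH) h₂.symm
    convert this using 1
    abel
  · have := (h₁.join (h.joins_right.mono hGH).symm (h.right.path.mono hGH).symm).join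
      (h.joins_left.mono hGH).symm h₂.symm
    rw [Multiset.coe_reverse, Multiset.coe_reverse] at this
    convert this using 1
    abel

lemma pathOn_left (h : Frame G H C p q I J a b c d (z :: A) B) (hGH : G ≤ H) :
    PathOn H C p z := by
  have := ((h.left.to_left.join (h.joins_right.mono hGH).symm (h.right.path.mono hGH).symm).extend
    (joins_cons.1 (h.joins_left.mono hGH)).2.symm)
  rw [← h.sum, ← Multiset.cons_coe, ← Multiset.singleton_add]
  rw [Multiset.coe_reverse, Multiset.coe_reverse] at this
  convert this using 1
  abel

end Frame

/-- A frame whose composed intervals have the largest possible total size. -/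
structure MaxFrame (G H : SimpleGraph V) (C : Multiset V) (p q : V) (I J : Multiset V)
    (a b c d : V) (A B : List V) : Prop extends Frame G H C p q I J a b c d A B where
  max : ∀ I' J' a' b' c' d' A' B', Frame G H C p q I' J' a' b' c' d' A' B' →
    I'.card + J'.card ≤ I.card + J.card

namespace MaxFrame

variable {G H : SimpleGraph V} {C I J : Multiset V} {p q a b c d s t z v : V} {A B : List V}

lemma mirror (h : MaxFrame G H C p q I J a b c d A B) :
    MaxFrame G H C p q I J b a d c B.reverse A.reverse :=
  { h.toFrame.mirror with max := h.max }

lemma swap (h : MaxFrame G H C p q I J a b c d A B) : MaxFrame G H C q p J I c d a b B A :=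
  { h.toFrame.swap with
    max := fun I' J' a' b' c' d' A' B' h' => by
      have := h.max _ _ _ _ _ _ _ _ h'.swap
      omega }

lemma not_adj_left (h : MaxFrame G H C p q I J a b c d (z :: A) B) (hGH : G ≤ H)
    (hC : C.Nodup) (ht : t ∈ I) (htb : t ≠ b) : ¬ H.Adj z t := by
  intro hzt
  have hz : z ∉ I := by
    intro hz
    rw [← h.sum, ← Multiset.cons_coe] at hC
    have := (Multiset.nodup_add.1 (Multiset.nodup_add.1 hC).1).2.2
    exact Multiset.disjoint_left.1 this (Multiset.mem_add.2 (.inl hz)) (Multiset.mem_cons_self _ _)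
  obtain ⟨hbz, hA⟩ := joins_cons.1 h.joins_left
  have := h.max _ _ _ _ _ _ _ _ ⟨h.left.extend hGH hz hbz hzt ht htb, h.right, hA, h.joins_right,
    by rw [← h.sum, ← Multiset.cons_coe, ← Multiset.singleton_add]; abel⟩
  simp at this

lemma not_adj_left_right (h : MaxFrame G H C p q I J a b c d (z :: A) (B ++ [v])) (hGH : G ≤ H)
    (hC : C.Nodup) : ¬ H.Adj z v := by
  intro hzv
  have hd : ∀ x ∈ I, x ≠ z ∧ x ≠ v := by
    rw [← h.sum, ← Multiset.cons_coe, ← Multiset.coe_add, Multiset.nodup_add,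
      Multiset.nodup_add] at hC
    intro x hx
    refine ⟨fun e => ?_, fun e => ?_⟩
    · exact Multiset.disjoint_left.1 hC.1.2.2 (Multiset.mem_add.2 (.inl hx)) (by simp [e])
    · exact Multiset.disjoint_left.1 hC.2.2 (Multiset.mem_add.2 (.inl (Multiset.mem_add.2
        (.inl hx)))) (by simp [e])
  obtain ⟨hbz, hA⟩ := joins_cons.1 h.joins_left
  obtain ⟨hB, hva⟩ := joins_append.1 h.joins_right
  have := h.max _ _ _ _ _ _ _ _ ⟨h.left.extend_both hGH (fun hz => (hd z hz).1 rfl)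
    (fun hv => (hd v hv).2 rfl) hbz (joins_nil.1 hva).symm hzv, h.right, hA, hB,
    by rw [← h.sum, ← Multiset.cons_coe, ← Multiset.singleton_add, ← Multiset.coe_add,
        Multiset.coe_singleton]; abel⟩
  simp at this

end MaxFrame

end Composed

section DegreeSums

variable {V : Type*} {H : SimpleGraph V}

lemma pathOn_of_append_cons {S M : List V} {u x : V} (h : (S ++ u :: M).IsChain H.Adj)
    (hx : (S ++ u :: M).head? = some x) : PathOn H ((S ++ [u] : List V) : Multiset V) x u := by
  have e : S ++ u :: M = (S ++ [u]) ++ M := by simp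
  rw [e, List.isChain_append] at h
  refine ⟨_, rfl, h.1, ?_, by simp⟩
  cases S <;> simpa using hx

lemma pathOn_of_cons_of_append {S T : List V} {w y : V} (h : (S ++ w :: T).IsChain H.Adj)
    (hy : (S ++ w :: T).getLast? = some y) : PathOn H ((w :: T : List V) : Multiset V) w y := by
  rw [List.isChain_append] at h
  refine ⟨_, rfl, h.2.1, by simp, ?_⟩
  rw [List.getLast?_append] at hy
  cases hq : (w :: T).getLast? with
  | none => simp at hq
  | some z => simpa [hq] using hy

lemma exists_rotation {C : Multiset V} {a b p : V} (h : PathOn H C a b) (hba : H.Adj b a)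
    (hp : p ∈ C) : ∃ L : List V, ((p :: L : List V) : Multiset V) = C ∧ (p :: L).IsChain H.Adj ∧
      ∃ x, (p :: L).getLast? = some x ∧ H.Adj x p := by
  obtain ⟨l, rfl, hl, hh, ht⟩ := h
  obtain ⟨S, T, rfl⟩ := List.append_of_mem (Multiset.mem_coe.1 hp)
  have h₂ := pathOn_of_cons_of_append hl ht
  rcases S.eq_nil_or_concat with rfl | ⟨S', x, rfl⟩
  · obtain rfl : p = a := by simpa using hh
    exact ⟨T, rfl, by simpa using hl, b, by simpa using ht, hba⟩
  · rw [List.concat_eq_append] at *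
    have hl' := List.isChain_append.1 hl
    refine ⟨T ++ (S' ++ [x]), ?_, ?_, x, ?_, ?_⟩
    · rw [← List.cons_append, Multiset.coe_eq_coe]
      exact List.perm_append_comm
    · rw [← List.cons_append]
      refine hl'.2.1.append hl'.1 ?_
      have : (p :: T).getLast? = some b := by
        obtain ⟨l', e, -, -, h⟩ := h₂
        rw [List.getLast?_append] at ht
        cases hq : (p :: T).getLast? with
        | none => simp at hq
        | some z => simpa [hq] using ht
      intro y hy z hz
      rw [this] at hy
      have hz' : z ∈ (S' ++ [x] ++ p :: T).head? := by
        rw [List.head?_append]; simp only [Option.mem_def] at hz; simp [hz]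
      rw [hh] at hz'
      simp at hy hz'
      exact hy ▸ hz' ▸ hba
    · rw [← List.append_assoc, ← List.cons_append, List.getLast?_append]; simp
    · exact hl'.2.2 x (by simp) p (by simp)

lemma exists_pathOn_of_isClique [DecidableEq V] {K : Finset V} (hK : (K : Set V).Pairwise H.Adj)
    {r : V} (hr : r ∈ K) : ∃ k ∈ K, PathOn H K.val k r := by
  have hl : ((K.erase r).toList ++ [r]).IsChain H.Adj := by
    have : ((K.erase r).toList ++ [r]).Nodup := by
      simp +contextual [List.nodup_append, (K.erase r).nodup_toList]
    refine List.Pairwise.isChain (List.Pairwise.imp_of_mem ?_ this)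
    intro a b ha hb hab
    refine hK ?_ ?_ hab
    · simp at ha; grind
    · simp at hb; grind
  have hval : (((K.erase r).toList ++ [r] : List V) : Multiset V) = K.val := by
    rw [← Multiset.coe_add, Finset.coe_toList, add_comm, Multiset.coe_singleton,
      Multiset.singleton_add, Finset.erase_val, Multiset.cons_erase hr]
  obtain ⟨k, hk⟩ : ∃ k, ((K.erase r).toList ++ [r]).head? = some k := by
    cases h : ((K.erase r).toList ++ [r]) with
    | nil => simp at h
    | cons k l => exact ⟨k, rfl⟩
  refine ⟨k, ?_, _, hval, hl, hk, by simp⟩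
  rw [← Finset.mem_val, ← hval]
  exact List.mem_of_mem_head? hk

lemma not_pathOn_of_joins {C : Multiset V} (hC : C.Nodup) (hcirc : CircLe H C.card)
    {R : List V} {p q : V} (hR : Joins H R p q) (hne : R ≠ []) (hnd : R.Nodup)
    (hout : ∀ x ∈ R, x ∉ C) : ¬ PathOn H C p q := by
  intro h
  cases R with
  | nil => exact hne rfl
  | cons r R =>
    obtain ⟨hpr, hR⟩ := joins_cons.1 hR
    have := hcirc _ _ _ ((PathOn.single H r).join hR h.symm) hpr (by
      rw [Multiset.singleton_add, Multiset.cons_coe, Multiset.nodup_add]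
      exact ⟨hnd, hC, Multiset.disjoint_left.2 fun hx => hout _ hx⟩)
    simp at this

variable [DecidableEq V] {G : SimpleGraph V} [DecidableRel G.Adj]

lemma countP_segment_le {L₁ : List V} {m₂ : Multiset V} {p q r x₁ y₁ x₂ y₂ : V} {K : Finset V}
    (hL₁ : L₁.IsChain H.Adj) (hL₂ : PathOn H m₂ y₂ x₂)
    (hnd : ({p} + {q} + (L₁ : Multiset V) + m₂).Nodup)
    (hcirc : CircLe H ({p} + {q} + (L₁ : Multiset V) + m₂).card)
    (hx₁ : L₁.head? = some x₁) (hy₁ : L₁.getLast? = some y₁)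
    (hpx₁ : G.Adj p x₁) (hqy₂ : H.Adj q y₂) (hx : H.Adj x₁ x₂) (hy : H.Adj y₁ y₂) (hGH : G ≤ H)
    (hK : ∀ x ∈ K, x ∉ {p} + {q} + (L₁ : Multiset V) + m₂ ∧ G.Adj p x)
    (hcl : (K : Set V).Pairwise H.Adj) (hr : r ∈ K) (hrq : G.Adj r q) :
    L₁.countP (fun x => G.Adj p x) + L₁.countP (fun x => G.Adj q x) + K.card ≤
      L₁.length + 1 := by
  obtain ⟨k, hk, hKp⟩ := exists_pathOn_of_isClique hcl hr
  have hpk : H.Adj p k := hGH (hK k hk).2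
  have hpath : PathOn H ({q} + K.val + {p}) q p :=
    ((PathOn.single H q).append (hGH hrq.symm) hKp.symm).snoc hpk.symm
  have hfin : ∀ m : Multiset V, m ≤ (L₁ : Multiset V) + m₂ →
      (m + ({q} + K.val + {p})).Nodup := by
    intro m hm
    have e : m + ({q} + K.val + {p}) = ({p} + {q} + m) + K.val := by abel
    have hle : {p} + {q} + m ≤ {p} + {q} + (L₁ : Multiset V) + m₂ := by
      rw [add_assoc _ (L₁ : Multiset V)]
      exact add_le_add_right hm _
    rw [e, Multiset.nodup_add]
    exact ⟨Multiset.nodup_of_le hle hnd, K.nodup, Multiset.disjoint_left.2 fun hx hx' =>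
      (hK _ hx').1 (Multiset.mem_of_le hle hx)⟩
  have hcard : K.card = Multiset.card K.val := rfl
  refine countP_add_countP_add_le (fun w => decide (G.Adj p w)) (fun w => decide (G.Adj q w))
    K.card (Finset.card_pos.2 ⟨r, hr⟩) L₁ ⟨x₁, List.mem_of_mem_head? hx₁, by simpa using hpx₁⟩ ?_ ?_
  · rintro S u M rfl hu
    simp only [decide_eq_true_eq] at hu
    have := hcirc _ _ _ (((pathOn_of_append_cons hL₁ hx₁).symm.append hx hL₂.symm).append hqy₂.symm
      hpath) (hGH hu) (hfin _ (add_le_add_left (Multiset.coe_le.2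
        (List.Sublist.subperm (by simp))) _))
    simp at this
    omega
  · rintro S u M w T rfl hu hw
    simp only [decide_eq_true_eq] at hu hw
    have hw2 : PathOn H ((w :: T : List V) : Multiset V) w y₁ := by
      rw [← List.cons_append, ← List.append_assoc] at hL₁ hy₁
      exact pathOn_of_cons_of_append hL₁ hy₁
    have := hcirc _ _ _ ((((pathOn_of_append_cons hL₁ hx₁).symm.append hx hL₂.symm).append hy.symm
      hw2.symm).append (hGH hw.symm) hpath) (hGH hu) (hfin _ (by
        rw [add_right_comm]
        refine add_le_add_left ?_ _
        rw [Multiset.coe_add]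
        exact Multiset.coe_le.2 (List.Sublist.subperm (by simp))))
    simp at this
    omega

variable [Fintype V]

lemma card_filter_notMem_and_add_length_le (P : V → Prop) [DecidablePred P] {l : List V}
    (hl : l.Nodup) : (Finset.univ.filter fun x => x ∉ l ∧ P x).card + l.length ≤
      Fintype.card V := by
  rw [← List.toFinset_card_of_nodup hl, ← Finset.card_union_of_disjoint]
  · exact Finset.card_le_univ _
  · rw [Finset.disjoint_left]
    simp +contextual

/-- The degree sum of `p` and of an outside vertex `o` at outside distance two from `p`. -/
lemma degree_add_degree_lt_of_outside {L T : List V} {p x₁ x₂ r o q : V}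
    {K : Finset V} (hL : L.IsChain H.Adj) (hnd : (p :: L).Nodup)
    (hcirc : CircLe H (p :: L).length)
    (hx₁ : L.head? = some x₁) (hx₂ : L.getLast? = some x₂) (hpx₁ : H.Adj p x₁)
    (hx : H.Adj x₁ x₂) (hGH : G ≤ H)
    (hK : ∀ x, x ∈ K ↔ x ∉ p :: L ∧ G.Adj p x) (hcl : (K : Set V).Pairwise H.Adj)
    (hr : r ∈ K) (ho : o ∉ p :: L) (hpo : ¬ G.Adj p o) (hro : G.Adj r o)
    (hT : Joins H T o q) (hq : q ∈ L) (hTnd : (o :: T).Nodup)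
    (hTK : ∀ x ∈ T, x ∉ p :: L ∧ ¬ G.Adj p x) : G.degree p + G.degree o < Fintype.card V := by
  classical
  obtain ⟨k, hk, hKp⟩ := exists_pathOn_of_isClique hcl hr
  have hpk : H.Adj p k := hGH ((hK k).1 hk).2
  set X : V → Prop := fun w => ∃ (R : Multiset V) (s t : V), PathOn H R s t ∧ R.Nodup ∧
    (∀ x ∈ R, x ∉ p :: L) ∧ K.card + 1 ≤ R.card ∧ H.Adj p s ∧ H.Adj t w with hXdef
  have hKo : PathOn H (K.val + {o}) k o := hKp.snoc (hGH hro)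
  have hoK : o ∉ K := fun h => hpo ((hK o).1 h).2
  have hKnd : (K.val + {o}).Nodup := by
    rw [add_comm, Multiset.singleton_add, Multiset.nodup_cons]
    exact ⟨hoK, K.nodup⟩
  have hKout : ∀ x ∈ K.val + {o}, x ∉ p :: L := by
    intro x hx
    rcases Multiset.mem_add.1 hx with hx | hx
    · exact ((hK x).1 hx).1
    · rw [Multiset.mem_singleton.1 hx]; exact ho
  have hX : ∀ w, G.Adj o w → X w := fun w hw =>
    ⟨_, _, _, hKo, hKnd, hKout, by simp, hpk, hGH hw⟩
  have hXq : X q := by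
    rcases T.eq_nil_or_concat with rfl | ⟨T', t, rfl⟩
    · exact ⟨_, _, _, hKo, hKnd, hKout, by simp, hpk, joins_nil.1 hT⟩
    · rw [List.concat_eq_append] at *
      obtain ⟨hT', htq⟩ := joins_append.1 hT
      refine ⟨_, _, _, hKo.extend hT', ?_, ?_, by simp; omega, hpk, joins_nil.1 htq⟩
      · rw [add_assoc, add_assoc, ← Multiset.coe_singleton t, Multiset.coe_add,
          Multiset.singleton_add, Multiset.cons_coe, Multiset.nodup_add]
        refine ⟨K.nodup, hTnd, Multiset.disjoint_left.2 fun hx hx' => ?_⟩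
        rw [Multiset.mem_coe, List.mem_cons] at hx'
        rcases hx' with rfl | hx'
        · exact hoK hx
        · exact (hTK _ hx').2 ((hK _).1 hx).2
      · intro x hx
        rw [add_assoc, add_assoc, ← Multiset.coe_singleton t, Multiset.coe_add,
          Multiset.singleton_add, Multiset.cons_coe, Multiset.mem_add, Multiset.mem_coe,
          List.mem_cons] at hx
        rcases hx with hx | rfl | hx
        · exact ((hK x).1 hx).1
        · exact ho
        · exact (hTK x hx).1
  have hgap := countP_add_countP_add_le (fun w => decide (X w)) (fun w => decide (G.Adj p w))
    (K.card + 1) (by omega) L ⟨q, hq, by simpa using hXq⟩ (by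
      rintro S u M rfl hu
      obtain ⟨R, s, t, h1, h2, h3, h4, h5, h6⟩ := of_decide_eq_true hu
      have := hcirc _ _ _ ((h1.append h6 (pathOn_of_append_cons hL hx₁).symm).snoc hpx₁.symm)
        h5 (by
          rw [add_assoc, Multiset.nodup_add]
          refine ⟨h2, ?_, Multiset.disjoint_left.2 fun hx hx' => h3 _ hx ?_⟩
          · rw [add_comm, Multiset.singleton_add, Multiset.cons_coe, Multiset.coe_nodup]
            refine hnd.sublist (List.Sublist.cons_cons _ ?_)
            simp
          · simp at hx' ⊢; tauto)
      simp at this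
      omega) (by
      rintro S u M w T' rfl hu hw
      obtain ⟨R, s, t, h1, h2, h3, h4, h5, h6⟩ := of_decide_eq_true hu
      simp only [decide_eq_true_eq] at hw
      have hw2 : PathOn H ((w :: T' : List V) : Multiset V) w x₂ := by
        rw [← List.cons_append, ← List.append_assoc] at hL hx₂
        exact pathOn_of_cons_of_append hL hx₂
      have := hcirc _ _ _ (((h1.append h6 (pathOn_of_append_cons hL hx₁).symm).append hx
        hw2.symm).snoc (hGH hw).symm)
        h5 (by
          rw [add_assoc, add_assoc, Multiset.nodup_add]
          refine ⟨h2, ?_, Multiset.disjoint_left.2 fun hx hx' => h3 _ hx ?_⟩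
          · rw [← add_assoc, add_comm, Multiset.singleton_add, Multiset.coe_add,
              Multiset.cons_coe, Multiset.coe_nodup]
            refine hnd.sublist (List.Sublist.cons_cons _ ?_)
            simp
          · simp at hx' ⊢; tauto)
      simp at this
      omega)
  have hp := degree_eq_countP_add G p hnd
  have ho' := degree_eq_countP_add G o hnd
  have e1 : (Finset.univ.filter fun x => x ∉ p :: L ∧ G.Adj p x) = K := by
    ext x; rw [hK]; simp
  have e2 : (Finset.univ.filter fun x => x ∉ p :: L ∧ G.Adj o x).card + (o :: p :: L).length ≤
      Fintype.card V := by
    refine le_trans (Nat.add_le_add_right (Finset.card_le_card ?_) _)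
      (card_filter_notMem_and_add_length_le (G.Adj o) (List.nodup_cons.2 ⟨ho, hnd⟩))
    intro x
    simp only [Finset.mem_filter, List.mem_cons, not_or]
    rintro ⟨h1, h2, h3⟩
    exact ⟨h1, ⟨h3.ne', h2⟩, h3⟩
  have e3 : L.countP (fun x => decide (G.Adj o x)) ≤ L.countP (fun x => decide (X x)) :=
    List.countP_mono_left fun x _ hx => by simpa using hX x (by simpa using hx)
  have hop : ¬ G.Adj o p := fun h => hpo h.symm
  rw [e1] at hp
  simp only [List.countP_cons, hop, G.irrefl, decide_false, Bool.false_eq_true, if_false, add_zero,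
    List.length_cons] at hp ho' e2
  omega

/-- The degree sum of two vertices of a longest cycle with a common neighbour outside. -/
lemma degree_add_degree_lt_of_common {L₁ L₂ : List V} {p q r x₁ y₁ x₂ y₂ : V} {K : Finset V}
    (hL₁ : L₁.IsChain H.Adj) (hL₂ : L₂.IsChain H.Adj)
    (hnd : (p :: L₁ ++ q :: L₂).Nodup) (hcirc : CircLe H (p :: L₁ ++ q :: L₂).length)
    (hx₁ : L₁.head? = some x₁) (hy₁ : L₁.getLast? = some y₁)
    (hy₂ : L₂.head? = some y₂) (hx₂ : L₂.getLast? = some x₂)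
    (hpx₁ : G.Adj p x₁) (hpx₂ : G.Adj p x₂) (hqy₁ : G.Adj q y₁) (hqy₂ : G.Adj q y₂)
    (hpq : ¬ G.Adj p q) (hx : H.Adj x₁ x₂) (hy : H.Adj y₁ y₂) (hGH : G ≤ H)
    (hK : ∀ x, x ∈ K ↔ x ∉ p :: L₁ ++ q :: L₂ ∧ G.Adj p x)
    (hcl : (K : Set V).Pairwise H.Adj) (hr : r ∈ K) (hrq : G.Adj r q) :
    G.degree p + G.degree q < Fintype.card V := by
  have e : {p} + {q} + (L₁ : Multiset V) + (L₂ : Multiset V) =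
      ((p :: L₁ ++ q :: L₂ : List V) : Multiset V) := by
    rw [← Multiset.coe_add, ← Multiset.cons_coe, ← Multiset.cons_coe, ← Multiset.singleton_add,
      ← Multiset.singleton_add]
    abel
  have hnd' : ({p} + {q} + (L₁ : Multiset V) + (L₂ : Multiset V)).Nodup := by
    rw [e]; exact hnd
  have hcirc' : CircLe H ({p} + {q} + (L₁ : Multiset V) + (L₂ : Multiset V)).card := by
    rw [e]; exact hcirc
  have hK' : ∀ x ∈ K, x ∉ {p} + {q} + (L₁ : Multiset V) + (L₂ : Multiset V) ∧ G.Adj p x := by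
    rw [e]; exact fun x hx => (hK x).1 hx
  have h₁ := countP_segment_le hL₁ ⟨L₂, rfl, hL₂, hy₂, hx₂⟩ hnd' hcirc' hx₁ hy₁ hpx₁ (hGH hqy₂)
    hx hy hGH hK' hcl hr hrq
  have e' : {p} + {q} + (L₁ : Multiset V) + (L₂ : Multiset V) =
      {p} + {q} + (L₂.reverse : Multiset V) + (L₁ : Multiset V) := by
    rw [Multiset.coe_reverse, add_right_comm]
  rw [e'] at hnd' hcirc' hK'
  have h₂ := countP_segment_le (L₁ := L₂.reverse)
    (by rw [List.isChain_reverse]; exact hL₂.imp fun _ _ h => h.symm)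
    (PathOn.symm ⟨L₁, rfl, hL₁, hx₁, hy₁⟩) hnd' hcirc' (by simpa using hx₂) (by simpa using hy₂)
    hpx₂ (hGH hqy₁) hx.symm hy.symm hGH hK' hcl hr hrq
  have hp := degree_eq_countP_add G p hnd
  have hq := degree_eq_countP_add G q hnd
  have e1 : (Finset.univ.filter fun x => x ∉ p :: L₁ ++ q :: L₂ ∧ G.Adj p x) = K := by
    ext x; rw [hK]; simp
  have e2 := card_filter_notMem_and_add_length_le (G.Adj q) hnd
  have hKpos : 0 < K.card := Finset.card_pos.2 ⟨r, hr⟩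
  have hqp : ¬ G.Adj q p := fun h => hpq h.symm
  rw [e1] at hp
  simp only [List.countP_cons, List.countP_append, hqp, hpq, G.irrefl, decide_false,
    Bool.false_eq_true, if_false, add_zero, List.length_cons, List.length_append,
    List.countP_reverse, List.length_reverse] at hp hq e2 h₁ h₂
  omega

end DegreeSums

section Embeddings

variable {V : Type*} {K : SimpleGraph V}

lemma netGraph_adj (i j : Fin 6) : netGraph.Adj i j ↔
    (i, j) ∈ [((0 : Fin 6), (1 : Fin 6)), (1, 0), (0, 2), (2, 0), (1, 2), (2, 1), (0, 3), (3, 0),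
      (1, 4), (4, 1), (2, 5), (5, 2)] := by
  fin_cases i <;> fin_cases j <;> simp [netGraph]

lemma woundedGraph_adj (i j : Fin 6) : woundedGraph.Adj i j ↔
    (i, j) ∈ [((0 : Fin 6), (1 : Fin 6)), (1, 0), (0, 2), (2, 0), (1, 2), (2, 1), (0, 3), (3, 0),
      (1, 4), (4, 1), (4, 5), (5, 4)] := by
  fin_cases i <;> fin_cases j <;> simp [woundedGraph]

/-- A map which preserves adjacency in both directions is an embedding if no two vertices of the
source have the same neighbours. -/
lemma exists_embedding_of_adj_iff {α : Type*} {X : SimpleGraph α} (f : α → V)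
    (hf : ∀ i j, K.Adj (f i) (f j) ↔ X.Adj i j)
    (hX : ∀ i j, (∀ k, X.Adj i k ↔ X.Adj j k) → i = j) : ∃ φ : X ↪g K, ∀ i, φ i = f i :=
  ⟨⟨⟨f, fun i j hij => hX i j fun k => by rw [← hf, ← hf, hij]⟩, hf _ _⟩, fun _ => rfl⟩

lemma adj_iff_of_lt {n : ℕ} {X : SimpleGraph (Fin n)} (f : Fin n → V)
    (hf : ∀ i j, i < j → (K.Adj (f i) (f j) ↔ X.Adj i j)) (i j : Fin n) :
    K.Adj (f i) (f j) ↔ X.Adj i j := by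
  rcases lt_trichotomy i j with h | rfl | h
  · exact hf i j h
  · simp
  · rw [K.adj_comm, X.adj_comm, hf j i h]

lemma exists_net_embedding {x₀ x₁ x₂ x₃ x₄ x₅ : V}
    (h₀₁ : K.Adj x₀ x₁) (h₀₂ : K.Adj x₀ x₂) (h₁₂ : K.Adj x₁ x₂) (h₀₃ : K.Adj x₀ x₃)
    (h₁₄ : K.Adj x₁ x₄) (h₂₅ : K.Adj x₂ x₅)
    (h₀₄ : ¬ K.Adj x₀ x₄) (h₀₅ : ¬ K.Adj x₀ x₅) (h₁₃ : ¬ K.Adj x₁ x₃) (h₁₅ : ¬ K.Adj x₁ x₅)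
    (h₂₃ : ¬ K.Adj x₂ x₃) (h₂₄ : ¬ K.Adj x₂ x₄) (h₃₄ : ¬ K.Adj x₃ x₄) (h₃₅ : ¬ K.Adj x₃ x₅)
    (h₄₅ : ¬ K.Adj x₄ x₅) : ∃ f : netGraph ↪g K, ∀ i, f i = ![x₀, x₁, x₂, x₃, x₄, x₅] i := by
  have hf : ∀ i j, K.Adj (![x₀, x₁, x₂, x₃, x₄, x₅] i) (![x₀, x₁, x₂, x₃, x₄, x₅] j) ↔
      netGraph.Adj i j := by
    refine adj_iff_of_lt _ fun i j hij => ?_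
    rw [netGraph_adj]
    fin_cases i <;> fin_cases j <;> first | exact absurd hij (by decide) | simp [*]
  have hX : ∀ i j, (∀ k, netGraph.Adj i k ↔ netGraph.Adj j k) → i = j := by
    simp only [netGraph_adj]; decide
  exact exists_embedding_of_adj_iff _ hf hX

lemma exists_wounded_embedding {x₀ x₁ x₂ x₃ x₄ x₅ : V}
    (h₀₁ : K.Adj x₀ x₁) (h₀₂ : K.Adj x₀ x₂) (h₁₂ : K.Adj x₁ x₂) (h₀₃ : K.Adj x₀ x₃)
    (h₁₄ : K.Adj x₁ x₄) (h₄₅ : K.Adj x₄ x₅)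
    (h₀₄ : ¬ K.Adj x₀ x₄) (h₀₅ : ¬ K.Adj x₀ x₅) (h₁₃ : ¬ K.Adj x₁ x₃) (h₁₅ : ¬ K.Adj x₁ x₅)
    (h₂₃ : ¬ K.Adj x₂ x₃) (h₂₄ : ¬ K.Adj x₂ x₄) (h₂₅ : ¬ K.Adj x₂ x₅) (h₃₄ : ¬ K.Adj x₃ x₄)
    (h₃₅ : ¬ K.Adj x₃ x₅) :
    ∃ f : woundedGraph ↪g K, ∀ i, f i = ![x₀, x₁, x₂, x₃, x₄, x₅] i := by
  have hf : ∀ i j, K.Adj (![x₀, x₁, x₂, x₃, x₄, x₅] i) (![x₀, x₁, x₂, x₃, x₄, x₅] j) ↔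
      woundedGraph.Adj i j := by
    refine adj_iff_of_lt _ fun i j hij => ?_
    rw [woundedGraph_adj]
    fin_cases i <;> fin_cases j <;> first | exact absurd hij (by decide) | simp [*]
  have hX : ∀ i j, (∀ k, woundedGraph.Adj i k ↔ woundedGraph.Adj j k) → i = j := by
    simp only [woundedGraph_adj]; decide
  exact exists_embedding_of_adj_iff _ hf hX

end Embeddings

section Pendant

variable {V : Type*} {K : SimpleGraph V}

lemma exists_geodesic {u w : V} (h : K.Reachable u w) : ∃ y : ℕ → V, y 0 = u ∧
    y (K.dist u w) = w ∧ (∀ i < K.dist u w, K.Adj (y i) (y (i + 1))) ∧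
    ∀ i ≤ K.dist u w, K.Reachable u (y i) ∧ K.dist u (y i) = i := by
  obtain ⟨p, hp⟩ := h.exists_walk_length_eq_dist
  refine ⟨p.getVert, by simp, by rw [← hp]; simp, fun i hi => p.adj_getVert_succ (hp ▸ hi),
    fun i hi => ⟨⟨p.take i⟩, le_antisymm ?_ ?_⟩⟩
  · have := dist_le (p.take i)
    rw [Walk.take_length] at this
    omega
  · obtain ⟨q, hq⟩ :=
      Reachable.exists_walk_length_eq_dist (⟨p.take i⟩ : K.Reachable u (p.getVert i))
    have := dist_le (q.append (p.drop i))
    rw [Walk.length_append, Walk.drop_length] at this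
    omega

lemma dist_le_of_adj {u x y : V} (h : K.Reachable u x) (hxy : K.Adj x y) :
    K.dist u y ≤ K.dist u x + 1 := by
  obtain ⟨q, hq⟩ := h.exists_walk_length_eq_dist
  have := dist_le (q.concat hxy)
  rw [Walk.length_concat] at this
  omega

/-- Three pendant vertices attached to distinct vertices of a connected claw-free graph force
an induced net, and an induced wounded unless their neighbours form a triangle. -/
lemma exists_net_of_pendant {p a b r v z : V} (hr : ∀ x, K.Adj r x ↔ x = p)
    (hv : ∀ x, K.Adj v x ↔ x = a) (hz : ∀ x, K.Adj z x ↔ x = b)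
    (hvz : K.Reachable v z) (hrv : K.Reachable r v) (hab : a ≠ b)
    (hne : v ≠ z ∧ r ≠ v ∧ r ≠ z ∧ v ≠ p ∧ z ≠ p ∧ v ≠ b)
    (hclaw : ∀ x y₁ y₂ y₃, K.Adj x y₁ → K.Adj x y₂ → K.Adj x y₃ → y₁ ≠ y₂ → y₁ ≠ y₃ → y₂ ≠ y₃ →
      K.Adj y₁ y₂ ∨ K.Adj y₁ y₃ ∨ K.Adj y₂ y₃) :
    Nonempty (netGraph ↪g K) ∧
      (Nonempty (woundedGraph ↪g K) ∨ (K.Adj p a ∧ K.Adj p b ∧ K.Adj a b)) := by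
  obtain ⟨hvz', hrv', hrz', hvp, hzp, hvb⟩ := hne
  obtain ⟨y, hy0, hyn, hyadj, hyd⟩ := exists_geodesic hvz
  set n := K.dist v z
  have hyj : ∀ i ≤ n, ∀ j ≤ n, y i = y j → i = j := fun i hi j hj h => by
    rw [← (hyd i hi).2, ← (hyd j hj).2, h]
  have hynadj : ∀ i ≤ n, ∀ j ≤ n, i + 1 < j → ¬ K.Adj (y i) (y j) := fun i hi j hj hij h => by
    have := dist_le_of_adj (hyd i hi).1 h
    rw [(hyd i hi).2, (hyd j hj).2] at this
    omega
  have hn0 : n ≠ 0 := fun h => hvz' (by rw [← hy0, ← hyn, h])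
  have hy1 : y 1 = a := (hv _).1 (by rw [← hy0]; exact hyadj 0 (by omega))
  have hyb : y (n - 1) = b := (hz _).1 (by
    have := hyadj (n - 1) (by omega)
    rw [Nat.sub_add_cancel (by omega), hyn] at this
    exact this.symm)
  have hn3 : 3 ≤ n := by
    by_contra! h
    have : n = 1 ∨ n = 2 := by omega
    rcases this with h | h
    · rw [h] at hyb; exact hvb (hy0.symm.trans hyb)
    · rw [h] at hyb; exact hab (hy1.symm.trans hyb)
  have hinner : ∀ i ≤ n, y i ≠ v → y i ≠ z → 0 < i ∧ i < n := fun i hi h1 h2 => by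
    refine ⟨Nat.pos_of_ne_zero fun h => h1 (by rw [h, hy0]), lt_of_le_of_ne hi fun h => ?_⟩
    exact h2 (by rw [h, hyn])
  have hrY : ∀ i ≤ n, y i ≠ r := by
    intro i hi h
    obtain ⟨h1, h2⟩ := hinner i hi (by rwa [h]) (by rwa [h])
    have h3 := (hr _).1 (h ▸ hyadj i h2)
    have h4 := hyadj (i - 1) (by omega)
    rw [Nat.sub_add_cancel h1] at h4
    have h4 := (hr _).1 (h ▸ h4.symm)
    have := hyj _ (by omega) _ (by omega) (h3.trans h4.symm)
    omega
  have hpY : ∀ i ≤ n, y i ≠ p := by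
    intro i hi h
    obtain ⟨h1, h2⟩ := hinner i hi (by rw [h]; exact hvp.symm) (by rw [h]; exact hzp.symm)
    have h3 := hyadj i h2
    have h4 := hyadj (i - 1) (by omega)
    rw [Nat.sub_add_cancel h1] at h4
    have hpr : K.Adj (y i) r := by rw [h]; exact ((hr p).2 rfl).symm
    rcases hclaw _ _ _ _ hpr h3 h4.symm (hrY _ (by omega)).symm (hrY _ (by omega)).symm
      (fun e => by have := hyj _ (by omega) _ (by omega) e; omega) with h5 | h5 | h5
    · exact h3.ne (h.trans ((hr _).1 h5).symm)
    · exact h4.ne' (h.trans ((hr _).1 h5).symm)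
    · exact hynadj (i - 1) (by omega) (i + 1) (by omega) (by omega) h5.symm
  have hreach : ∀ i ≤ n, K.Reachable r (y i) := fun i hi => hrv.trans (hyd i hi).1
  obtain ⟨i₀, hi₀, hmin⟩ := Finset.exists_min_image (Finset.range (n + 1))
    (fun i => K.dist r (y i)) ⟨0, by simp⟩
  simp only [Finset.mem_range, Nat.lt_succ_iff] at hi₀ hmin
  obtain ⟨x, hx0, hxm, hxadj, hxd⟩ := exists_geodesic (hreach i₀ hi₀)
  set m := K.dist r (y i₀)
  have hxY : ∀ j < m, ∀ i ≤ n, x j ≠ y i := by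
    intro j hj i hi h
    have := hmin i hi
    rw [← h, (hxd j hj.le).2] at this
    omega
  have hxYadj : ∀ j, j + 1 < m → ∀ i ≤ n, ¬ K.Adj (x j) (y i) := by
    intro j hj i hi h
    have h1 := hmin i hi
    have h2 := dist_le_of_adj (hxd j (by omega)).1 h
    rw [(hxd j (by omega)).2] at h2
    omega
  have hm0 : m ≠ 0 := by
    intro h
    rw [h, hx0] at hxm
    exact hrY i₀ hi₀ hxm.symm
  have hx1 : x 1 = p := (hr _).1 (by rw [← hx0]; exact hxadj 0 (by omega))
  have hm2 : 2 ≤ m := by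
    by_contra! h
    have : m = 1 := by omega
    rw [this, hx1] at hxm
    exact hpY i₀ hi₀ hxm.symm
  obtain ⟨s, hs⟩ : ∃ s, m = s + 2 := ⟨m - 2, by omega⟩
  have hex : ∃ i, i ≤ n ∧ K.Adj (x (s + 1)) (y i) := ⟨i₀, hi₀, by
    have := hxadj (s + 1) (by omega)
    rwa [show s + 1 + 1 = m by omega, hxm] at this⟩
  classical
  obtain ⟨hin, hadj⟩ := Nat.find_spec hex
  have hfirst : ∀ j < Nat.find hex, j ≤ n → ¬ K.Adj (x (s + 1)) (y j) := fun j hj hjn h =>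
    Nat.find_min hex hj ⟨hjn, h⟩
  set i := Nat.find hex
  have hpos : ∀ j ≤ n, K.Adj (x (s + 1)) (y j) → 0 < j ∧ j < n := by
    intro j hj h
    refine ⟨Nat.pos_of_ne_zero ?_, lt_of_le_of_ne hj ?_⟩ <;> rintro rfl
    · rw [hy0] at h
      exact hxY (s + 1) (by omega) 1 (by omega) (((hv _).1 h.symm).trans hy1.symm)
    · rw [hyn] at h
      exact hxY (s + 1) (by omega) (n - 1) (by omega) (((hz _).1 h.symm).trans hyb.symm)
  obtain ⟨hi1, hi2⟩ := hpos i hin hadj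
  obtain ⟨k, hk⟩ : ∃ k, i = k + 1 := ⟨i - 1, by omega⟩
  rw [hk] at hadj hi2 hfirst
  have hk1 := hyadj k (by omega)
  have hk2 := hyadj (k + 1) (by omega)
  have hxk : ¬ K.Adj (x (s + 1)) (y k) := hfirst k (by omega) (by omega)
  have hadj2 : K.Adj (x (s + 1)) (y (k + 2)) := by
    rcases hclaw _ _ _ _ hadj.symm hk1.symm hk2 (hxY _ (by omega) _ (by omega))
      (hxY _ (by omega) _ (by omega))
      (fun e => by have := hyj _ (by omega) _ (by omega) e; omega) with h | h | h
    · exact absurd h hxk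
    · exact h
    · exact absurd h (hynadj _ (by omega) _ (by omega) (by omega))
  have hk3n := (hpos _ (by omega) hadj2).2
  have hk3 := hyadj (k + 2) hk3n
  have hw := hxadj s (by omega)
  have hwY : ∀ i ≤ n, ¬ K.Adj (x s) (y i) := hxYadj s (by omega)
  have hfar : ∀ t ≤ n, k + 2 < t → ¬ K.Adj (x (s + 1)) (y t) := by
    intro t ht hkt h
    rcases hclaw _ _ _ _ hw.symm hadj h (hxY _ (by omega) _ (by omega))
      (hxY _ (by omega) _ (by omega))
      (fun e => by have := hyj _ (by omega) _ (by omega) e; omega) with h | h | h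
    · exact hwY _ (by omega) h
    · exact hwY _ (by omega) h
    · exact hynadj _ (by omega) _ (by omega) (by omega) h
  have hYn : ∀ i ≤ n, ∀ j ≤ n, i + 1 < j → ¬ K.Adj (y j) (y i) := fun i hi j hj hij h =>
    hynadj i hi j hj hij h.symm
  constructor
  · obtain ⟨f, -⟩ := exists_net_embedding hadj hadj2 hk2 hw.symm hk1.symm hk3 hxk
      (hfar _ (by omega) (by omega)) (fun h => hwY _ (by omega) h.symm)
      (hynadj _ (by omega) _ (by omega) (by omega)) (fun h => hwY _ (by omega) h.symm)
      (hYn _ (by omega) _ (by omega) (by omega)) (hwY _ (by omega)) (hwY _ (by omega))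
      (hynadj _ (by omega) _ (by omega) (by omega))
    exact ⟨f⟩
  by_cases hs1 : 1 ≤ s
  · left
    obtain ⟨t, rfl⟩ : ∃ t, s = t + 1 := ⟨s - 1, by omega⟩
    have htY : ∀ i ≤ n, ¬ K.Adj (y i) (x t) := fun i hi h => hxYadj t (by omega) i hi h.symm
    have hwY' : ∀ i ≤ n, ¬ K.Adj (y i) (x (t + 1)) := fun i hi h => hwY i hi h.symm
    obtain ⟨f, -⟩ := exists_wounded_embedding hadj.symm hk2 hadj2 hk1.symm hw.symm
      (hxadj t (by omega)).symm (hwY' _ (by omega)) (htY _ (by omega)) hxk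
      (fun h => by
        have := dist_le_of_adj (hxd t (by omega)).1 h.symm
        rw [(hxd t (by omega)).2, (hxd _ (by omega)).2] at this
        omega)
      (hYn _ (by omega) _ (by omega) (by omega)) (hwY' _ (by omega)) (htY _ (by omega))
      (hwY' _ (by omega)) (htY _ (by omega))
    exact ⟨f⟩
  by_cases hk' : 1 ≤ k
  · left
    obtain ⟨t, rfl⟩ : ∃ t, k = t + 1 := ⟨k - 1, by omega⟩
    obtain ⟨f, -⟩ := exists_wounded_embedding hk2.symm hadj2.symm hadj.symm hk3 hk1.symm
      (hyadj t (by omega)).symm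
      (hYn _ (by omega) _ (by omega) (by omega)) (hYn _ (by omega) _ (by omega) (by omega))
      (hynadj _ (by omega) _ (by omega) (by omega)) (hYn _ (by omega) _ (by omega) (by omega))
      (hfar _ (by omega) (by omega)) hxk (hfirst _ (by omega) (by omega))
      (hYn _ (by omega) _ (by omega) (by omega)) (hYn _ (by omega) _ (by omega) (by omega))
    exact ⟨f⟩
  by_cases hn' : k + 4 ≤ n
  · left
    obtain ⟨f, -⟩ := exists_wounded_embedding hk2 hadj.symm hadj2.symm hk1.symm hk3
      (hyadj (k + 3) (by omega))
      (hynadj _ (by omega) _ (by omega) (by omega)) (hynadj _ (by omega) _ (by omega) (by omega))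
      (hYn _ (by omega) _ (by omega) (by omega)) (hynadj _ (by omega) _ (by omega) (by omega))
      hxk (hfar _ (by omega) (by omega)) (hfar _ (by omega) (by omega))
      (hynadj _ (by omega) _ (by omega) (by omega)) (hynadj _ (by omega) _ (by omega) (by omega))
    exact ⟨f⟩
  right
  obtain rfl : s = 0 := by omega
  obtain rfl : k = 0 := by omega
  rw [show n - 1 = 0 + 2 by omega] at hyb
  rw [hyb] at hadj2 hk2
  simp only [zero_add, hx1, hy1] at hadj hadj2 hk2
  exact ⟨hadj, hadj2, hk2⟩

end Pendant

section Light

variable {V α : Type*}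

/-- `X` is an induced subgraph of `G` and of `H` on the same set of vertices. -/
def Light (G H : SimpleGraph V) (X : SimpleGraph α) : Prop :=
  ∃ f : X ↪g G, ∀ i j, H.Adj (f i) (f j) → X.Adj i j

lemma Light.of_embedding {G H K : SimpleGraph V} {X : SimpleGraph α} {U : Set V} (hGH : G ≤ H)
    (hK : ∀ x y, K.Adj x y ↔ H.Adj x y ∧ x ∈ U ∧ y ∈ U)
    (hU : ∀ x ∈ U, ∀ y ∈ U, H.Adj x y → G.Adj x y) (hX : ∀ i, ∃ j, X.Adj i j)
    (h : Nonempty (X ↪g K)) : Light G H X := by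
  obtain ⟨f⟩ := h
  have hf : ∀ i, f i ∈ U := fun i => by
    obtain ⟨j, hj⟩ := hX i
    exact ((hK _ _).1 (f.map_adj_iff.2 hj)).2.1
  refine ⟨⟨f.toEmbedding, fun {i j} => ⟨fun h => f.map_adj_iff.1 ((hK _ _).2
    ⟨hGH h, hf i, hf j⟩), fun h => hU _ (hf i) _ (hf j) ((hK _ _).1 (f.map_adj_iff.2 h)).1⟩⟩,
    fun i j h => f.map_adj_iff.1 ((hK _ _).2 ⟨h, hf i, hf j⟩)⟩

lemma reachable_of_isChain {K : SimpleGraph V} {l : List V} (hl : l.IsChain K.Adj) {x y : V}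
    (hx : x ∈ l) (hy : y ∈ l) : K.Reachable x y := by
  have key : ∀ {l : List V} {u : V}, (u :: l).IsChain K.Adj → ∀ x ∈ u :: l, K.Reachable u x := by
    intro l
    induction l with
    | nil => intro u _ x hx; simp_all
    | cons w l ih =>
      intro u hl x hx
      obtain ⟨h, hl⟩ := List.isChain_cons_cons.1 hl
      rcases List.mem_cons.1 hx with rfl | hx
      · exact .refl _
      · exact h.reachable.trans (ih hl x hx)
  cases l with
  | nil => simp at hx
  | cons u l => exact (key hl x hx).symm.trans (key hl y hy)

end Light

section Core

variable {V : Type*} {G H : SimpleGraph V} {C I J : Multiset V} {p q a b c d r : V}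
  {A B : List V}

/-- An interval of a maximal frame in which `G` and `H` agree yields a net and a wounded. -/
lemma MaxFrame.light (h : MaxFrame G H C p q I J a b c d A B) (hGH : G ≤ H) (hC : C.Nodup)
    (hno : ¬ PathOn H C p q)
    (hclaw : ∀ x y₁ y₂ y₃, G.Adj x y₁ → G.Adj x y₂ → G.Adj x y₃ → y₁ ≠ y₂ → y₁ ≠ y₃ → y₂ ≠ y₃ →
      H.Adj y₁ y₂ ∨ H.Adj y₁ y₃ ∨ H.Adj y₂ y₃)
    (hpr : G.Adj p r) (hrC : r ∉ C) (hr : ∀ s, PathOn H C p s → ¬ H.Adj r s)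
    (hI : ∀ x ∈ I, ∀ y ∈ I, H.Adj x y → G.Adj x y) :
    Light G H netGraph ∧
      (Light G H woundedGraph ∨ (G.Adj p a ∧ G.Adj p b ∧ G.Adj a b)) := by
  obtain ⟨z, A, rfl⟩ := List.exists_cons_of_ne_nil (h.left_ne_nil hGH hno)
  obtain ⟨B, v, rfl⟩ : ∃ B' v, B = B' ++ [v] := by
    rcases B.eq_nil_or_concat with e | ⟨B', v, e⟩
    · exact absurd e (h.right_ne_nil hGH hno)
    · exact ⟨B', v, by simpa using e⟩
  have hm : MaxFrame G H C p q I J b a d c (v :: B.reverse) (z :: A).reverse := by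
    simpa using h.mirror
  have hzI : ∀ t ∈ I, t ≠ b → ¬ H.Adj z t := fun t ht htb => h.not_adj_left hGH hC ht htb
  have hvI : ∀ t ∈ I, t ≠ a → ¬ H.Adj v t := fun t ht hta => hm.not_adj_left hGH hC ht hta
  have hzv : ¬ H.Adj z v := h.not_adj_left_right hGH hC
  have hrz : ¬ H.Adj r z := hr _ (h.pathOn_left hGH)
  have hrv : ¬ H.Adj r v := hr _ (hm.pathOn_left hGH)
  have hrI : ∀ t ∈ I, t ≠ p → ¬ H.Adj r t := fun t ht htp => hr _ (h.pathOn_of_mem hGH ht htp)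
  have hsub : ∀ x, x ∈ I ∨ x = z ∨ x = v → x ∈ C := by
    rw [← h.sum]
    rintro x (hx | rfl | rfl) <;> simp [*]
  have hrU : ∀ x, x ∈ I ∨ x = z ∨ x = v → r ≠ x := fun x hx e => hrC (e ▸ hsub x hx)
  obtain ⟨hzI', hvI', hvz⟩ : z ∉ I ∧ v ∉ I ∧ v ≠ z := by
    have h1 := hC
    rw [← h.sum, Multiset.nodup_add, Multiset.nodup_add] at h1
    refine ⟨fun hz => ?_, fun hv => ?_, ?_⟩
    · exact Multiset.disjoint_left.1 h1.1.2.2 (Multiset.mem_add.2 (.inl hz)) (by simp)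
    · exact Multiset.disjoint_left.1 h1.2.2 (Multiset.mem_add.2 (.inl (Multiset.mem_add.2
        (.inl hv)))) (by simp)
    · rintro rfl
      exact Multiset.disjoint_left.1 h1.2.2 (Multiset.mem_add.2 (.inr (by simp : v ∈ _)))
        (by simp)
  have hpI := h.left.mem
  have haI := h.left.path.left_mem
  have hbI := h.left.path.right_mem
  have hbz : G.Adj b z := (joins_cons.1 h.joins_left).1
  have hav : G.Adj a v := (joins_cons.1 hm.joins_left).1
  set U : Set V := {x | x ∈ I ∨ x = r ∨ x = z ∨ x = v} with hUdef
  have hIU : ∀ x ∈ I, x ∈ U := fun x hx => .inl hx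
  have hU : ∀ x ∈ U, ∀ y ∈ U, H.Adj x y → G.Adj x y := by
    have key : ∀ x ∈ U, ∀ y, y = r ∨ y = z ∨ y = v → H.Adj y x → G.Adj y x := by
      rintro x (hx | rfl | rfl | rfl) y (rfl | rfl | rfl) hyx
      · exact (of_not_not fun e => hrI x hx e hyx : x = p) ▸ hpr.symm
      · exact (of_not_not fun e => hzI x hx e hyx : x = b) ▸ hbz.symm
      · exact (of_not_not fun e => hvI x hx e hyx : x = a) ▸ hav.symm
      · exact (hyx.ne rfl).elim
      · exact (hrz hyx.symm).elim
      · exact (hrv hyx.symm).elim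
      · exact (hrz hyx).elim
      · exact (hyx.ne rfl).elim
      · exact (hzv hyx.symm).elim
      · exact (hrv hyx).elim
      · exact (hzv hyx).elim
      · exact (hyx.ne rfl).elim
    intro x hx y hy hxy
    by_cases hx' : x ∈ I
    · by_cases hy' : y ∈ I
      · exact hI x hx' y hy' hxy
      · exact (key x hx y (hy.resolve_left hy') hxy.symm).symm
    · exact key y hy x (hx.resolve_left hx') hxy
  let K : SimpleGraph V :=
    { Adj := fun x y => H.Adj x y ∧ x ∈ U ∧ y ∈ U
      symm := ⟨fun x y h => ⟨h.1.symm, h.2.2, h.2.1⟩⟩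
      loopless := ⟨fun x h => h.1.ne rfl⟩ }
  have hK : ∀ x y, K.Adj x y ↔ H.Adj x y ∧ x ∈ U ∧ y ∈ U := fun _ _ => Iff.rfl
  have hrUm : r ∈ U := .inr (.inl rfl)
  have hzUm : z ∈ U := .inr (.inr (.inl rfl))
  have hvUm : v ∈ U := .inr (.inr (.inr rfl))
  have hrK : K.Adj r p := ⟨hGH hpr.symm, hrUm, hIU p hpI⟩
  have hzK : K.Adj z b := ⟨hGH hbz.symm, hzUm, hIU b hbI⟩
  have hvK : K.Adj v a := ⟨hGH hav.symm, hvUm, hIU a haI⟩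
  have hpend : ∀ {y t : V}, K.Adj y t → (∀ x ∈ I, x ≠ t → ¬ H.Adj y x) → ¬ H.Adj y r →
      ¬ H.Adj y z → ¬ H.Adj y v → ∀ x, K.Adj y x ↔ x = t := by
    intro y t hyt h1 h2 h3 h4 x
    refine ⟨fun ⟨hyx, _, hx⟩ => ?_, fun e => e ▸ hyt⟩
    rcases hx with hx | rfl | rfl | rfl
    · exact of_not_not fun e => h1 x hx e hyx
    · exact (h2 hyx).elim
    · exact (h3 hyx).elim
    · exact (h4 hyx).elim
  have hreach : ∀ x ∈ I, ∀ y ∈ I, K.Reachable x y := by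
    obtain ⟨l, hlI, hl, -, -⟩ := h.left.path
    have hmem : ∀ x, x ∈ I ↔ x ∈ l := fun x => by rw [← hlI]; simp
    intro x hx y hy
    refine reachable_of_isChain (l := l) ?_ ((hmem x).1 hx) ((hmem y).1 hy)
    exact hl.imp_of_mem_imp fun u w hu hw huw =>
      ⟨hGH huw, hIU u ((hmem u).2 hu), hIU w ((hmem w).2 hw)⟩
  obtain ⟨hN, hW⟩ := exists_net_of_pendant (K := K) (p := p) (a := a) (b := b)
    (r := r) (v := v) (z := z)
    (hpend hrK hrI H.irrefl hrz hrv)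
    (hpend hvK hvI (fun h => hrv h.symm) (fun h => hzv h.symm) H.irrefl)
    (hpend hzK hzI (fun h => hrz h.symm) H.irrefl hzv)
    ((hvK.reachable.trans (hreach a haI b hbI)).trans hzK.reachable.symm)
    ((hrK.reachable.trans (hreach p hpI a haI)).trans hvK.reachable.symm)
    h.left.ne ⟨hvz, hrU v (by simp), hrU z (by simp), fun e => hvI' (e ▸ hpI),
      fun e => hzI' (e ▸ hpI), fun e => hvI' (e ▸ hbI)⟩
    (fun x y₁ y₂ y₃ h₁ h₂ h₃ n₁ n₂ n₃ => by
      have hG : ∀ y, K.Adj x y → G.Adj x y := fun y hy => hU _ hy.2.1 _ hy.2.2 hy.1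
      rcases hclaw _ _ _ _ (hG _ h₁) (hG _ h₂) (hG _ h₃) n₁ n₂ n₃ with h | h | h
      · exact .inl ⟨h, h₁.2.2, h₂.2.2⟩
      · exact .inr (.inl ⟨h, h₁.2.2, h₃.2.2⟩)
      · exact .inr (.inr ⟨h, h₂.2.2, h₃.2.2⟩))
  refine ⟨.of_embedding hGH hK hU ?_ hN, hW.imp (.of_embedding hGH hK hU ?_) ?_⟩
  · simp only [netGraph_adj]; decide
  · simp only [woundedGraph_adj]; decide
  · exact fun ⟨h₁, h₂, h₃⟩ => ⟨hU _ h₁.2.1 _ h₁.2.2 h₁.1, hU _ h₂.2.1 _ h₂.2.2 h₂.1,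
      hU _ h₃.2.1 _ h₃.2.2 h₃.1⟩

/-- In a frame of a non-hamiltonian graph, `G` and `H` agree on one of the two intervals. -/
lemma Frame.left_or_right [Fintype V] [DecidableRel G.Adj]
    (h : Frame G (heavyClosure G) C p q I J a b c d A B)
    (hC : C.Nodup) (hno : ¬ PathOn (heavyClosure G) C p q) :
    (∀ x ∈ I, ∀ y ∈ I, (heavyClosure G).Adj x y → G.Adj x y) ∨
      (∀ x ∈ J, ∀ y ∈ J, (heavyClosure G).Adj x y → G.Adj x y) := by
  by_contra! hcon
  obtain ⟨⟨x, hx, y, hy, hxy, hxy'⟩, s, hs, t, ht, hst, hst'⟩ := hcon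
  have hIJ : ∀ u ∈ I, ∀ w ∈ J, u ≠ w := by
    rintro u hu w hw rfl
    have h1 := hC
    rw [← h.sum, Multiset.nodup_add, Multiset.nodup_add, Multiset.nodup_add] at h1
    exact Multiset.disjoint_left.1 h1.1.1.2.2 hu hw
  have key : ∀ u ∈ I, ∀ w ∈ J, Fintype.card V ≤ G.degree u + G.degree w →
      (u = p ∧ w = q) ∨ (u = b ∧ w = c) ∨ (u = a ∧ w = d) := fun u hu w hw huw =>
    h.eq_of_adj le_heavyClosure hno hu hw ⟨hIJ u hu w hw, .inr huw⟩
  have h1 := hxy.2.resolve_left hxy'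
  have h2 := hst.2.resolve_left hst'
  have hxs := key x hx s hs
  have hxt := key x hx t ht
  have hys := key y hy s hs
  have hyt := key y hy t ht
  have e1 : Fintype.card V ≤ G.degree x + G.degree s ∨
      Fintype.card V ≤ G.degree y + G.degree t := by
    omega
  have e2 : Fintype.card V ≤ G.degree x + G.degree t ∨
      Fintype.card V ≤ G.degree y + G.degree s := by
    omega
  have n1 := hxy.1
  have n2 := hst.1
  have := h.left.ne
  have := h.left.ne_left
  have := h.left.ne_right
  have := h.right.ne
  have := h.right.ne_left
  have := h.right.ne_right
  rcases e1 with e1 | e1 <;> rcases e2 with e2 | e2 <;> grind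

/-- A maximal frame together with a path outside of it yields a wounded. -/
lemma MaxFrame.light_wounded (h : MaxFrame G H C p q I J a b c d A B) (hGH : G ≤ H) (hC : C.Nodup)
    (hno : ¬ PathOn H C p q)
    (hclaw : ∀ x y₁ y₂ y₃, G.Adj x y₁ → G.Adj x y₂ → G.Adj x y₃ → y₁ ≠ y₂ → y₁ ≠ y₃ → y₂ ≠ y₃ →
      H.Adj y₁ y₂ ∨ H.Adj y₁ y₃ ∨ H.Adj y₂ y₃)
    (hpr : G.Adj p r) (hrC : r ∉ C) (hr : ∀ s, PathOn H C p s → ¬ H.Adj r s)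
    (hI : ∀ x ∈ I, ∀ y ∈ I, H.Adj x y → G.Adj x y)
    (hcase : (∃ o, G.Adj r o ∧ ¬ H.Adj p o ∧ ∀ s, PathOn H C p s → ¬ H.Adj o s) ∨
      (G.Adj r q ∧ (∀ s, PathOn H C q s → ¬ H.Adj r s) ∧ (G.Adj p q ∨ ¬ H.Adj p q))) :
    Light G H woundedGraph := by
  rcases (h.light hGH hC hno hclaw hpr hrC hr hI).2 with hW | ⟨hpa, hpb, hab⟩
  · exact hW
  obtain ⟨z, A, rfl⟩ := List.exists_cons_of_ne_nil (h.left_ne_nil hGH hno)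
  have hzI : ∀ t ∈ I, t ≠ b → ¬ H.Adj z t := fun t ht htb => h.not_adj_left hGH hC ht htb
  have haI := h.left.path.left_mem
  have hbI := h.left.path.right_mem
  have hbz : G.Adj b z := (joins_cons.1 h.joins_left).1
  have hpz : ¬ H.Adj z p := hzI p h.left.mem h.left.ne_right
  have hza : ¬ H.Adj z a := hzI a haI h.left.ne
  have hPa := h.pathOn_of_mem hGH haI h.left.ne_left.symm
  have hPb := h.pathOn_of_mem hGH hbI h.left.ne_right.symm
  have hPz := h.pathOn_left hGH
  have key : ∀ {x₀ x₁ x₂ x₃ x₄ x₅ : V}, G.Adj x₀ x₁ → G.Adj x₀ x₂ → G.Adj x₁ x₂ → G.Adj x₀ x₃ →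
      G.Adj x₁ x₄ → G.Adj x₄ x₅ → ¬ H.Adj x₀ x₄ → ¬ H.Adj x₀ x₅ → ¬ H.Adj x₁ x₃ → ¬ H.Adj x₁ x₅ →
      ¬ H.Adj x₂ x₃ → ¬ H.Adj x₂ x₄ → ¬ H.Adj x₂ x₅ → ¬ H.Adj x₃ x₄ → ¬ H.Adj x₃ x₅ →
      Light G H woundedGraph := by
    intro x₀ x₁ x₂ x₃ x₄ x₅ h₀₁ h₀₂ h₁₂ h₀₃ h₁₄ h₄₅ h₀₄ h₀₅ h₁₃ h₁₅ h₂₃ h₂₄ h₂₅ h₃₄ h₃₅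
    obtain ⟨f, hf⟩ := exists_wounded_embedding h₀₁ h₀₂ h₁₂ h₀₃ h₁₄ h₄₅ (mt (@hGH _ _) h₀₄)
      (mt (@hGH _ _) h₀₅) (mt (@hGH _ _) h₁₃) (mt (@hGH _ _) h₁₅) (mt (@hGH _ _) h₂₃)
      (mt (@hGH _ _) h₂₄) (mt (@hGH _ _) h₂₅) (mt (@hGH _ _) h₃₄) (mt (@hGH _ _) h₃₅)
    obtain ⟨g, hg⟩ := exists_wounded_embedding (hGH h₀₁) (hGH h₀₂) (hGH h₁₂) (hGH h₀₃) (hGH h₁₄)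
      (hGH h₄₅) h₀₄ h₀₅ h₁₃ h₁₅ h₂₃ h₂₄ h₂₅ h₃₄ h₃₅
    refine ⟨f, fun i j hij => ?_⟩
    rw [hf, hf, ← hg, ← hg] at hij
    exact g.map_adj_iff.1 hij
  have sym : ∀ {x y : V}, ¬ H.Adj x y → ¬ H.Adj y x := fun h h' => h h'.symm
  have hbq : ∀ t ∈ J, t ≠ c → ¬ H.Adj b t := fun t ht htc hbt => by
    rcases h.eq_of_adj hGH hno hbI ht hbt with e | e | e
    · exact h.left.ne_right e.1.symm
    · exact htc e.2
    · exact h.left.ne e.1.symm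
  have haq : ∀ t ∈ J, t ≠ d → ¬ H.Adj a t := fun t ht htd hat => by
    rcases h.eq_of_adj hGH hno haI ht hat with e | e | e
    · exact h.left.ne_left e.1.symm
    · exact h.left.ne e.1
    · exact htd e.2
  have hpJ : ∀ t ∈ J, t ≠ q → ¬ H.Adj p t := fun t ht htq hpt => by
    rcases h.eq_of_adj hGH hno h.left.mem ht hpt with e | e | e
    · exact htq e.2
    · exact h.left.ne_right e.1
    · exact h.left.ne_left e.1
  have hzJ : ∀ t ∈ J, t ≠ c → ¬ H.Adj z t := fun t ht htc hzt =>
    htc (h.eq_of_adj_left hGH hno ht hzt)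
  have hqJ := h.right.mem
  have hqc := h.right.ne_left
  have hqd := h.right.ne_right
  rcases hcase with ⟨o, hro, hpo, ho⟩ | ⟨hrq, hrq', hpq⟩
  · exact key hpb.symm hab.symm hpa hbz hpr hro (sym (hr b hPb)) (sym (ho b hPb)) (sym hpz) hpo
      (sym hza) (sym (hr a hPa)) (sym (ho a hPa)) (sym (hr z hPz)) (sym (ho z hPz))
  rcases hpq with hpq | hpq
  · obtain ⟨y, hyJ, hqy, hyc⟩ := h.right.nbr c
    have hry : ¬ H.Adj r y := hrq' y (h.swap.pathOn_of_mem hGH hyJ hqy.ne.symm)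
    exact key hpq.symm hrq.symm hpr hqy hpb hbz (sym (hbq q hqJ hqc)) (sym (hzJ q hqJ hqc))
      (hpJ y hyJ hqy.ne.symm) (sym hpz) hry (hr b hPb) (hr z hPz) (sym (hbq y hyJ hyc))
      (sym (hzJ y hyJ hyc))
  · exact key hpb.symm hab.symm hpa hbz hpr hrq (sym (hr b hPb)) (hbq q hqJ hqc) (sym hpz) hpq
      (sym hza) (sym (hr a hPa)) (haq q hqJ hqd) (sym (hr z hPz)) (hzJ q hqJ hqc)

end Core

section Ear

variable {V : Type*}

/-- `R` is the interior of a path of `G` which joins distinct vertices `p`, `q` of `C` outside `C`,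
and it is shortest possible among all choices of `p` and `q`. -/
structure Ear (G : SimpleGraph V) (C : Multiset V) (p q : V) (R : List V) : Prop where
  left_mem : p ∈ C
  right_mem : q ∈ C
  ne : p ≠ q
  joins : Joins G R p q
  ne_nil : R ≠ []
  nodup : R.Nodup
  notMem : ∀ x ∈ R, x ∉ C
  min : ∀ p' q' R', p' ∈ C → q' ∈ C → p' ≠ q' → Joins G R' p' q' → R' ≠ [] → R'.Nodup →
    (∀ x ∈ R', x ∉ C) → R.length ≤ R'.length

variable {G : SimpleGraph V} {C : Multiset V} {p q r : V} {R : List V}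

lemma Ear.symm (h : Ear G C p q R) : Ear G C q p R.reverse where
  left_mem := h.right_mem
  right_mem := h.left_mem
  ne := h.ne.symm
  joins := h.joins.symm
  ne_nil := by simpa using h.ne_nil
  nodup := by simpa using h.nodup
  notMem := by simpa using h.notMem
  min := by simpa using h.min

lemma Ear.not_adj (h : Ear G C p q (r :: R)) : ∀ x ∈ R, ¬ G.Adj p x := by
  intro x hx hpx
  obtain ⟨S, T, rfl⟩ := List.append_of_mem hx
  have hj := h.joins
  rw [← List.cons_append, joins_append] at hj
  have := h.min p q (x :: T) h.left_mem h.right_mem h.ne (joins_cons.2 ⟨hpx, hj.2⟩) (by simp)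
    (h.nodup.sublist (by simp)) (fun y hy => h.notMem y (by simp at hy ⊢; tauto))
  simp at this
  omega

lemma exists_joins_of_walk {u w : V} (W : G.Walk u w) (hp : p ∉ W.support) (hu : u ∉ C)
    (hw : w ∈ C) : ∃ T q, q ∈ C ∧ q ≠ p ∧ (u :: T).Nodup ∧ (∀ x ∈ u :: T, x ∉ C) ∧
      Joins G T u q := by
  induction W with
  | nil => exact absurd hw hu
  | @cons u v w h W ih =>
    rw [Walk.support_cons, List.mem_cons, not_or] at hp
    by_cases hv : v ∈ C
    · exact ⟨[], v, hv, fun e => hp.2 (e ▸ W.start_mem_support), by simp, by simpa using hu,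
        joins_nil.2 h⟩
    obtain ⟨T, q, hq, hqp, hnd, hout, hj⟩ := ih hp.2 hv hw
    by_cases hu' : u ∈ v :: T
    · obtain ⟨S, T', e⟩ := List.append_of_mem hu'
      rw [e] at hnd hout
      refine ⟨T', q, hq, hqp, hnd.sublist (by simp),
        fun x hx => hout x (by simp at hx ⊢; tauto), ?_⟩
      have hj' : Joins G (v :: T) u q := joins_cons.2 ⟨h, hj⟩
      rw [e] at hj'
      exact (joins_append.1 hj').2
    · exact ⟨v :: T, q, hq, hqp, List.nodup_cons.2 ⟨hu', hnd⟩, by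
        simpa using ⟨hu, by simpa using hout⟩, joins_cons.2 ⟨h, hj⟩⟩

lemma exists_walk_of_twoConnected [Fintype V] (hG : TwoConnected G) {p u w : V} (hu : u ≠ p)
    (hw : w ≠ p) : ∃ W : G.Walk u w, p ∉ W.support := by
  have key : ∀ {x y} (_ : (G.induce ({p}ᶜ : Set V)).Walk x y),
      ∃ W : G.Walk x.1 y.1, p ∉ W.support := by
    intro x y W
    induction W with
    | @nil x => exact ⟨.nil, by simpa using Ne.symm (x.2 : x.1 ≠ p)⟩
    | @cons x _ _ h _ ih =>
      obtain ⟨W, hW⟩ := ih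
      have h' : G.Adj x.1 _ := induce_adj.1 h
      refine ⟨.cons h' W, ?_⟩
      rw [Walk.support_cons, List.mem_cons, not_or]
      exact ⟨Ne.symm (x.2 : x.1 ≠ p), hW⟩
  obtain ⟨W⟩ := (hG.2 p).preconnected ⟨u, hu⟩ ⟨w, hw⟩
  exact key W

lemma exists_ear [Fintype V] (hG : TwoConnected G) {o : V} (ho : o ∉ C)
    (hC : ∀ x, ∃ y ∈ C, y ≠ x) : ∃ p q R, Ear G C p q R := by
  obtain ⟨c, hc, hco⟩ := hC o
  classical
  obtain ⟨w, hwo, hwc⟩ : ∃ w, w ≠ o ∧ w ≠ c := by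
    obtain ⟨w, -, hw⟩ := Finset.exists_mem_notMem_of_card_lt_card
      (s := {o, c}) (t := (Finset.univ : Finset V))
      ((Finset.card_le_two).trans_lt (by rw [Finset.card_univ]; exact hG.1))
    exact ⟨w, by simpa using hw⟩
  obtain ⟨W, hW⟩ := exists_walk_of_twoConnected hG hwo.symm hwc.symm
  obtain ⟨T, p, hp, -, -, hout, hj⟩ := exists_joins_of_walk W hW ho hc
  obtain ⟨r, hr, hpr⟩ : ∃ r, r ∉ C ∧ G.Adj p r := by
    rcases T.eq_nil_or_concat with rfl | ⟨S, x, rfl⟩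
    · exact ⟨o, ho, (joins_nil.1 hj).symm⟩
    · rw [List.concat_eq_append] at hj hout
      exact ⟨x, hout x (by simp), (joins_nil.1 (joins_append.1 hj).2).symm⟩
  obtain ⟨c', hc', hcp⟩ := hC p
  obtain ⟨W', hW'⟩ := exists_walk_of_twoConnected hG (fun e => hr (e ▸ hp) : r ≠ p) hcp
  obtain ⟨T', q, hq, hqp, hnd', hout', hj'⟩ := exists_joins_of_walk W' hW' hr hc'
  let P : ℕ → Prop := fun n => ∃ p' q' R', p' ∈ C ∧ q' ∈ C ∧ p' ≠ q' ∧ Joins G R' p' q' ∧ R' ≠ [] ∧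
    R'.Nodup ∧ (∀ x ∈ R', x ∉ C) ∧ R'.length = n
  have hP : ∃ n, P n := ⟨_, p, q, r :: T', hp, hq, hqp.symm, joins_cons.2 ⟨hpr, hj'⟩, by simp, hnd',
    hout', rfl⟩
  obtain ⟨p', q', R', h1, h2, h3, h4, h5, h6, h7, h8⟩ := Nat.find_spec hP
  exact ⟨p', q', R', h1, h2, h3, h4, h5, h6, h7, fun p'' q'' R'' g1 g2 g3 g4 g5 g6 g7 =>
    h8 ▸ Nat.find_min' hP ⟨p'', q'', R'', g1, g2, g3, g4, g5, g6, g7, rfl⟩⟩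

end Ear

section Split

variable {V : Type*} {G H : SimpleGraph V} {C : Multiset V} {p q r a b : V} {L₁ L₂ : List V}

/-- `C` is a cycle which consists of `p`, `L₁`, `q`, `L₂` in this order. -/
structure CycleSplit (G : SimpleGraph V) (C : Multiset V) (p q : V) (L₁ L₂ : List V) : Prop where
  joins₁ : Joins G L₁ p q
  joins₂ : Joins G L₂ q p
  sum : ((p :: L₁ ++ q :: L₂ : List V) : Multiset V) = C

namespace CycleSplit

lemma sum' (h : CycleSplit G C p q L₁ L₂) : {p} + {q} + (L₁ : Multiset V) + L₂ = C := by
  rw [← h.sum, ← Multiset.coe_add, ← Multiset.cons_coe, ← Multiset.cons_coe,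
    ← Multiset.singleton_add, ← Multiset.singleton_add]
  abel

lemma of_sum (h₁ : Joins G L₁ p q) (h₂ : Joins G L₂ q p)
    (hs : {p} + {q} + (L₁ : Multiset V) + L₂ = C) : CycleSplit G C p q L₁ L₂ :=
  ⟨h₁, h₂, by
    rw [← hs, ← Multiset.coe_add, ← Multiset.cons_coe, ← Multiset.cons_coe,
      ← Multiset.singleton_add, ← Multiset.singleton_add]
    abel⟩

lemma mirror (h : CycleSplit G C p q L₁ L₂) : CycleSplit G C p q L₂.reverse L₁.reverse :=
  .of_sum h.joins₂.symm h.joins₁.symm (by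
    rw [← h.sum', Multiset.coe_reverse, Multiset.coe_reverse, add_right_comm])

lemma swap (h : CycleSplit G C p q L₁ L₂) : CycleSplit G C q p L₂ L₁ :=
  .of_sum h.joins₂ h.joins₁ (by rw [← h.sum']; abel)

lemma mono (h : CycleSplit G C p q L₁ L₂) (hGH : G ≤ H) : CycleSplit H C p q L₁ L₂ :=
  ⟨h.joins₁.mono hGH, h.joins₂.mono hGH, h.sum⟩

lemma left_ne_nil (h : CycleSplit H C p q L₁ L₂) (hno : ¬ PathOn H C p q) : L₁ ≠ [] := by
  rintro rfl
  refine hno ?_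
  have := h.joins₂.symm.pathOn
  rw [← h.sum']
  convert this using 1
  rw [Multiset.coe_reverse, Multiset.coe_nil]
  abel

lemma right_ne_nil (h : CycleSplit H C p q L₁ L₂) (hno : ¬ PathOn H C p q) : L₂ ≠ [] := by
  simpa using h.mirror.left_ne_nil hno

lemma pathOn_last (h : CycleSplit H C p q L₁ (L₂ ++ [a])) : PathOn H C p a := by
  have := ((PathOn.single H p).extend h.joins₁).extend (joins_append.1 h.joins₂).1
  rw [← h.sum', ← Multiset.coe_add, Multiset.coe_singleton]
  convert this using 1
  abel

lemma pathOn_head (h : CycleSplit H C p q (b :: L₁) L₂) : PathOn H C p b := by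
  have := h.mirror
  rw [List.reverse_cons] at this
  exact this.pathOn_last

lemma tail_ne_nil (h : CycleSplit H C p q (b :: L₁) (L₂ ++ [a])) (hno : ¬ PathOn H C p q)
    (hba : H.Adj b a) : L₁ ≠ [] := by
  rintro rfl
  refine hno ?_
  have := (((PathOn.single H p).snoc (joins_cons.1 h.joins₁).1).snoc hba).extend
    (joins_append.1 h.joins₂).1.symm
  rw [← h.sum', ← Multiset.coe_add, Multiset.coe_singleton, Multiset.coe_singleton]
  convert this using 1
  rw [Multiset.coe_reverse]
  abel

end CycleSplit

lemma not_adj_of_pathOn (hC : C.Nodup) (hcirc : CircLe H C.card) (hpr : H.Adj p r) (hr : r ∉ C)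
    {s : V} (hs : PathOn H C p s) : ¬ H.Adj r s := fun hrs =>
  not_pathOn_of_joins hC hcirc (R := [r]) (joins_cons.2 ⟨hpr, joins_nil.2 hrs⟩) (by simp) (by simp)
    (by simpa using hr) hs

end Split

section Sufficiency

variable {V : Type*} {G H : SimpleGraph V} {C : Multiset V} {p q : V} {L₁ L₂ R : List V}

lemma CycleSplit.exists_heads (h : CycleSplit G C p q L₁ L₂) (hR : Ear G C p q R) (hGH : G ≤ H)
    (hC : C.Nodup) (hcirc : CircLe H C.card) (hno : ¬ PathOn H C p q)
    (hclaw : ∀ x y₁ y₂ y₃, G.Adj x y₁ → G.Adj x y₂ → G.Adj x y₃ → y₁ ≠ y₂ → y₁ ≠ y₃ → y₂ ≠ y₃ →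
      H.Adj y₁ y₂ ∨ H.Adj y₁ y₃ ∨ H.Adj y₂ y₃) :
    ∃ b M₁ M₂ a, L₁ = b :: M₁ ∧ L₂ = M₂ ++ [a] ∧ M₁ ≠ [] ∧ H.Adj a b := by
  obtain ⟨b, M₁, rfl⟩ := List.exists_cons_of_ne_nil ((h.mono hGH).left_ne_nil hno)
  obtain ⟨M₂, a, rfl⟩ : ∃ M₂ a, L₂ = M₂ ++ [a] := by
    rcases L₂.eq_nil_or_concat with e | ⟨M₂, a, e⟩
    · exact absurd e ((h.mono hGH).right_ne_nil hno)
    · exact ⟨M₂, a, by simpa using e⟩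
  obtain ⟨r, R, rfl⟩ := List.exists_cons_of_ne_nil hR.ne_nil
  have hpr := (joins_cons.1 hR.joins).1
  have hr := hR.notMem r (by simp)
  have hmem : b ∈ C ∧ a ∈ C ∧ b ≠ a := by
    rw [← h.sum] at hC ⊢
    rw [Multiset.coe_nodup] at hC
    refine ⟨by simp, by simp, ?_⟩
    rintro rfl
    simp at hC
  have hab : H.Adj a b := by
    rcases hclaw p r b a hpr (joins_cons.1 h.joins₁).1
      (joins_nil.1 (joins_append.1 h.joins₂).2).symm (fun e => hr (e ▸ hmem.1))
      (fun e => hr (e ▸ hmem.2.1)) hmem.2.2 with e | e | e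
    · exact absurd e (not_adj_of_pathOn hC hcirc (hGH hpr) hr (h.mono hGH).pathOn_head)
    · exact absurd e (not_adj_of_pathOn hC hcirc (hGH hpr) hr (h.mono hGH).pathOn_last)
    · exact e.symm
  exact ⟨b, M₁, M₂, a, rfl, rfl, (h.mono hGH).tail_ne_nil hno hab.symm, hab⟩

/-- A cycle with an ear can be arranged as a frame. -/
lemma CycleSplit.exists_frame (h : CycleSplit G C p q L₁ L₂) (hR : Ear G C p q R) (hGH : G ≤ H)
    (hC : C.Nodup) (hcirc : CircLe H C.card) (hno : ¬ PathOn H C p q)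
    (hclaw : ∀ x y₁ y₂ y₃, G.Adj x y₁ → G.Adj x y₂ → G.Adj x y₃ → y₁ ≠ y₂ → y₁ ≠ y₃ → y₂ ≠ y₃ →
      H.Adj y₁ y₂ ∨ H.Adj y₁ y₃ ∨ H.Adj y₂ y₃) :
    ∃ a b c d A B, L₁ = b :: (A ++ [c]) ∧ L₂ = d :: (B ++ [a]) ∧ H.Adj a b ∧ H.Adj c d ∧
      Frame G H C p q ({a} + {p} + {b}) ({c} + {q} + {d}) a b c d A B := by
  obtain ⟨b, M₁, M₂, a, rfl, rfl, hM₁, hab⟩ := h.exists_heads hR hGH hC hcirc hno hclaw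
  obtain ⟨d, N₂, N₁, c, e₂, e₁, hN₂, hcd⟩ :=
    h.swap.exists_heads hR.symm hGH hC hcirc (fun h => hno h.symm) hclaw
  obtain ⟨A, c', rfl⟩ : ∃ A c', M₁ = A ++ [c'] := by
    rcases M₁.eq_nil_or_concat with e | ⟨A, c', e⟩
    · exact absurd e hM₁
    · exact ⟨A, c', by simpa using e⟩
  obtain ⟨B, a', rfl⟩ : ∃ B a', N₂ = B ++ [a'] := by
    rcases N₂.eq_nil_or_concat with e | ⟨A, c', e⟩
    · exact absurd e hN₂
    · exact ⟨A, c', by simpa using e⟩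
  rw [← List.cons_append] at e₁ e₂
  obtain ⟨rfl, e₁⟩ := List.append_inj' e₁ rfl
  obtain ⟨rfl, e₂⟩ := List.append_inj' e₂ rfl
  obtain rfl : c' = c := by simpa using e₁
  obtain rfl : a = a' := by simpa using e₂
  obtain ⟨hpb, hj₁⟩ := joins_cons.1 h.joins₁
  obtain ⟨hj₁, hcq⟩ := joins_append.1 hj₁
  obtain ⟨hj₂, hap⟩ := joins_append.1 h.joins₂
  obtain ⟨hqd, hj₂⟩ := joins_cons.1 hj₂
  refine ⟨a, b, c', d, A, B, rfl, rfl, hab, hcd, Comp.base hGH (joins_nil.1 hap) hpb hab,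
    Comp.base hGH (joins_nil.1 hcq) hqd hcd, hj₁, hj₂, ?_⟩
  rw [← h.sum', ← Multiset.coe_add, ← Multiset.cons_coe, ← Multiset.cons_coe, ← Multiset.coe_add,
    ← Multiset.singleton_add, ← Multiset.singleton_add, Multiset.coe_singleton,
    Multiset.coe_singleton]
  abel

lemma exists_maxFrame {I J : Multiset V} {a b c d : V} {A B : List V}
    (h : Frame G H C p q I J a b c d A B) :
    ∃ I J a b c d A B, MaxFrame G H C p q I J a b c d A B := by
  classical
  let P : ℕ → Prop := fun n => ∃ I J a b c d A B, Frame G H C p q I J a b c d A B ∧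
    n = I.card + J.card
  have hb : ∀ n, P n → n ≤ C.card := by
    rintro n ⟨I, J, a, b, c, d, A, B, h, rfl⟩
    rw [← h.sum]
    simp only [Multiset.card_add]
    omega
  have h0 : P (I.card + J.card) := ⟨I, J, a, b, c, d, A, B, h, rfl⟩
  obtain ⟨I', J', a', b', c', d', A', B', h', e⟩ := Nat.findGreatest_spec (hb _ h0) h0
  exact ⟨I', J', a', b', c', d', A', B', h', fun I'' J'' a'' b'' c'' d'' A'' B'' h'' => by
    have h1 : P (I''.card + J''.card) := ⟨I'', J'', a'', b'', c'', d'', A'', B'', h'', rfl⟩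
    rw [← e]
    exact Nat.le_findGreatest (hb _ h1) h1⟩

variable [Fintype V] [DecidableEq V] [DecidableRel G.Adj]

/-- The degree conditions at the ends of an ear of a longest cycle. -/
lemma CycleSplit.exists_outside (h : CycleSplit G C p q L₁ L₂)
    (hR : Ear G C p q R) (hC : C.Nodup) (hcirc : CircLe (heavyClosure G) C.card)
    (hno : ¬ PathOn (heavyClosure G) C p q)
    (hclaw : ∀ x y₁ y₂ y₃, G.Adj x y₁ → G.Adj x y₂ → G.Adj x y₃ → y₁ ≠ y₂ → y₁ ≠ y₃ → y₂ ≠ y₃ →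
      (heavyClosure G).Adj y₁ y₂ ∨ (heavyClosure G).Adj y₁ y₃ ∨ (heavyClosure G).Adj y₂ y₃) :
    ∃ r, G.Adj p r ∧ r ∉ C ∧ (∀ s, PathOn (heavyClosure G) C p s → ¬ (heavyClosure G).Adj r s) ∧
      ((∃ o, G.Adj r o ∧ ¬ (heavyClosure G).Adj p o ∧
          ∀ s, PathOn (heavyClosure G) C p s → ¬ (heavyClosure G).Adj o s) ∨
        (G.Adj r q ∧ (∀ s, PathOn (heavyClosure G) C q s → ¬ (heavyClosure G).Adj r s) ∧
          (G.Adj p q ∨ ¬ (heavyClosure G).Adj p q))) := by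
  obtain ⟨a, b, c, d, A, B, rfl, rfl, hab, hcd, -⟩ :=
    h.exists_frame hR le_heavyClosure hC hcirc hno hclaw
  obtain ⟨r, R, rfl⟩ := List.exists_cons_of_ne_nil hR.ne_nil
  obtain ⟨hpr, hj⟩ := joins_cons.1 hR.joins
  have hr := hR.notMem r (by simp)
  obtain ⟨hpb, -⟩ := joins_cons.1 h.joins₁
  have hpa : G.Adj a p := by
    have := h.joins₂
    rw [← List.cons_append, joins_append] at this
    exact joins_nil.1 this.2
  have hmem : ∀ x, x ∈ C ↔ x ∈ p :: (b :: (A ++ [c])) ++ q :: (d :: (B ++ [a])) := fun x => by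
    rw [← h.sum]; rfl
  have hb : b ∈ C := (hmem b).2 (by simp)
  have hPb := (h.mono le_heavyClosure).pathOn_head
  set K : Finset V := Finset.univ.filter fun x => x ∉ C ∧ G.Adj p x with hKdef
  have hK : ∀ x, x ∈ K ↔ x ∉ C ∧ G.Adj p x := fun x => by simp [hKdef]
  have hcl : (K : Set V).Pairwise (heavyClosure G).Adj := by
    intro x hx y hy hxy
    have hx := (hK x).1 hx
    have hy := (hK y).1 hy
    rcases hclaw p x y b hx.2 hy.2 hpb hxy (fun e => hx.1 (e ▸ hb)) (fun e => hy.1 (e ▸ hb))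
      with e | e | e
    · exact e
    · exact absurd e (not_adj_of_pathOn hC hcirc (le_heavyClosure hx.2) hx.1 hPb)
    · exact absurd e (not_adj_of_pathOn hC hcirc (le_heavyClosure hy.2) hy.1 hPb)
  have hrK : r ∈ K := (hK r).2 ⟨hr, hpr⟩
  have hcard : C.card = (p :: (b :: (A ++ [c])) ++ q :: (d :: (B ++ [a]))).length := by
    rw [← h.sum]; rfl
  have hnd : (p :: (b :: (A ++ [c])) ++ q :: (d :: (B ++ [a]))).Nodup := by
    rw [← h.sum] at hC; exact hC
  refine ⟨r, hpr, hr, fun s hs => not_adj_of_pathOn hC hcirc (le_heavyClosure hpr) hr hs, ?_⟩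
  have hL₁ : (p :: (b :: (A ++ [c])) ++ [q]).IsChain (heavyClosure G).Adj :=
    h.joins₁.mono le_heavyClosure
  have hL₂ : (q :: (d :: (B ++ [a])) ++ [p]).IsChain (heavyClosure G).Adj :=
    h.joins₂.mono le_heavyClosure
  cases R with
  | cons o R =>
    left
    obtain ⟨hro, hj⟩ := joins_cons.1 hj
    have hpo := hR.not_adj
    have ho := hR.notMem o (by simp)
    refine ⟨o, hro, fun hpo' => ?_, fun s hs hos => ?_⟩
    · refine absurd (hpo'.2.resolve_left (hpo o (by simp))) (not_le.2 ?_)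
      refine degree_add_degree_lt_of_outside (H := heavyClosure G)
        (L := b :: (A ++ [c]) ++ q :: (d :: (B ++ [a]))) (T := R) (x₁ := b) (x₂ := a) (r := r)
        (q := q) (K := K) ?_ hnd (by rw [hcard] at hcirc; exact hcirc) (by simp)
        (by simp [List.getLast?_cons, List.getLast?_append]) (le_heavyClosure hpb) hab.symm
        le_heavyClosure
        (fun x => by rw [hK, hmem]; rfl) hcl hrK ?_ (hpo o (by simp)) hro
        (hj.mono le_heavyClosure) (by simp) (List.nodup_cons.1 hR.nodup).2 ?_
      · have := (List.isChain_append.1 hL₁)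
        exact (List.isChain_cons.1 this.1).2.append (List.isChain_append.1 hL₂).1
          (by simpa using this.2.2)
      · exact fun h => ho ((hmem o).2 h)
      · exact fun x hx => ⟨fun h => hR.notMem x (by simp [hx]) ((hmem x).2 h), hpo x (by simp [hx])⟩
    · exact not_pathOn_of_joins hC hcirc (R := [r, o])
        (joins_cons.2 ⟨le_heavyClosure hpr, joins_cons.2 ⟨le_heavyClosure hro, joins_nil.2 hos⟩⟩)
        (by simp) (by simpa using hro.ne) (by simpa using ⟨hr, ho⟩) hs
  | nil =>
    right
    have hrq := joins_nil.1 hj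
    refine ⟨hrq, fun s hs => not_adj_of_pathOn hC hcirc (le_heavyClosure hrq.symm) hr hs, ?_⟩
    by_contra! hpq
    refine absurd (hpq.2.2.resolve_left hpq.1) (not_le.2 ?_)
    refine degree_add_degree_lt_of_common (H := heavyClosure G) (L₁ := b :: (A ++ [c]))
      (L₂ := d :: (B ++ [a])) (x₁ := b) (y₁ := c) (y₂ := d) (x₂ := a) (r := r) (K := K)
      (List.isChain_cons.1 (List.isChain_append.1 hL₁).1).2
      (List.isChain_cons.1 (List.isChain_append.1 hL₂).1).2 hnd
      (by rw [hcard] at hcirc; exact hcirc) (by simp) (by simp [List.getLast?_cons])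
      (by simp) (by simp [List.getLast?_cons]) hpb hpa.symm ?_ (joins_cons.1 h.joins₂).1 hpq.1
      hab.symm hcd
      le_heavyClosure (fun x => by rw [hK, hmem]) hcl hrK hrq
    have := h.joins₁
    rw [← List.cons_append, joins_append] at this
    exact (joins_nil.1 this.2).symm

/-- The circumference argument: a longest cycle is a Hamilton cycle. -/
lemma exists_cycle_of_light (hG : TwoConnected G)
    (hclaw : ∀ x y₁ y₂ y₃, G.Adj x y₁ → G.Adj x y₂ → G.Adj x y₃ → y₁ ≠ y₂ → y₁ ≠ y₃ → y₂ ≠ y₃ →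
      (heavyClosure G).Adj y₁ y₂ ∨ (heavyClosure G).Adj y₁ y₃ ∨ (heavyClosure G).Adj y₂ y₃)
    (hX : ¬ Light G (heavyClosure G) netGraph ∨ ¬ Light G (heavyClosure G) woundedGraph) :
    ∃ C a b, PathOn G C a b ∧ G.Adj b a ∧ C.Nodup ∧ ∀ x, x ∈ C := by
  let P : ℕ → Prop := fun n => ∃ C a b, PathOn G C a b ∧ G.Adj b a ∧ C.Nodup ∧ n = C.card
  have hP : ∀ n, P n → n ≤ Fintype.card V := by
    rintro n ⟨C, a, b, -, -, hC, rfl⟩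
    simpa using Multiset.card_le_card (Multiset.le_iff_subset hC |>.2
      (fun x _ => Finset.mem_univ x :
      C ⊆ (Finset.univ : Finset V).val))
  have hP2 : P 2 := by
    obtain ⟨u, w, x, huw, hux, hwx⟩ := Fintype.two_lt_card_iff.1 (show 2 < Fintype.card V from hG.1)
    obtain ⟨W, -⟩ := exists_walk_of_twoConnected hG hux hwx
    cases W with
    | nil => exact absurd rfl huw
    | @cons _ y _ h _ => exact ⟨{u} + {y}, u, y, (PathOn.single G u).snoc h, h.symm, by
        simpa using h.ne, rfl⟩
  classical
  obtain ⟨C, a₀, b₀, hCab, hab₀, hC, e⟩ := Nat.findGreatest_spec (hP _ hP2) hP2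
  have hmax : ∀ n, P n → n ≤ C.card := fun n hn => e ▸ Nat.le_findGreatest (hP _ hn) hn
  have hC2 : 2 ≤ C.card := hmax 2 hP2
  refine ⟨C, a₀, b₀, hCab, hab₀, hC, ?_⟩
  by_contra! ho
  obtain ⟨o, ho⟩ := ho
  have hcirc : CircLe (heavyClosure G) C.card :=
    circLe_heavyClosure hC2 fun m a b h hba hm => hmax _ ⟨m, a, b, h, hba, hm, rfl⟩
  obtain ⟨p, q, R, hR⟩ := exists_ear hG ho fun x => by
    by_cases h : a₀ = x
    · exact ⟨b₀, hCab.right_mem, h ▸ hab₀.ne⟩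
    · exact ⟨a₀, hCab.left_mem, h⟩
  obtain ⟨L, hL, hch, x, hx, hxp⟩ := exists_rotation hCab hab₀ hR.left_mem
  have hqL : q ∈ L := by
    have := hR.right_mem
    rw [← hL] at this
    exact (List.mem_cons.1 this).resolve_left hR.ne.symm
  obtain ⟨L₁, L₂, rfl⟩ := List.append_of_mem hqL
  have hs : CycleSplit G C p q L₁ L₂ := by
    rw [← List.cons_append] at hch hx
    obtain ⟨h₁, h₂⟩ := List.isChain_split.1 hch
    refine ⟨h₁, ?_, hL⟩
    rw [Joins, ← List.cons_append]
    refine h₂.append (by simp) ?_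
    rw [List.getLast?_append_of_ne_nil _ (by simp)] at hx
    simpa [hx] using hxp
  have hno : ¬ PathOn (heavyClosure G) C p q :=
    not_pathOn_of_joins hC hcirc (hR.joins.mono le_heavyClosure) hR.ne_nil hR.nodup hR.notMem
  obtain ⟨a, b, c, d, A, B, -, -, -, -, hF⟩ :=
    hs.exists_frame hR le_heavyClosure hC hcirc hno hclaw
  obtain ⟨I, J, a, b, c, d, A, B, hF⟩ := exists_maxFrame hF
  obtain ⟨r, hpr, hrC, hr, hcase⟩ := hs.exists_outside hR hC hcirc hno hclaw
  have hno' : ¬ PathOn (heavyClosure G) C q p := fun h => hno h.symm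
  obtain ⟨r', hpr', hrC', hr', hcase'⟩ := hs.swap.exists_outside hR.symm hC hcirc hno' hclaw
  rcases hF.left_or_right hC hno with hI | hJ
  · rcases hX with hX | hX
    · exact hX (hF.light le_heavyClosure hC hno hclaw hpr hrC hr hI).1
    · exact hX (hF.light_wounded le_heavyClosure hC hno hclaw hpr hrC hr hI hcase)
  · rcases hX with hX | hX
    · exact hX (hF.swap.light le_heavyClosure hC hno' hclaw hpr' hrC' hr' hJ).1
    · exact hX (hF.swap.light_wounded le_heavyClosure hC hno' hclaw hpr' hrC' hr' hJ hcase')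

end Sufficiency

lemma isHamiltonian_of_pathOn {V : Type*} [Fintype V] [DecidableEq V] {G : SimpleGraph V}
    {C : Multiset V} {a b : V} (h : PathOn G C a b) (hba : G.Adj b a) (hC : C.Nodup)
    (hmem : ∀ x, x ∈ C) (hcard : 3 ≤ Fintype.card V) : G.IsHamiltonian := by
  obtain ⟨l, rfl, hl, ha, hb⟩ := h
  have hne : l ≠ [] := by rintro rfl; simp at ha
  have hnd : l.Nodup := by simpa using hC
  have hlen : l.length = Fintype.card V := by
    rw [← List.toFinset_card_of_nodup hnd, ← Finset.card_univ]
    congr 1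
    ext x
    simpa using hmem x
  have ha' : l.head hne = a := by simpa [List.head?_eq_some_head hne] using ha
  have hb' : l.getLast hne = b := by simpa [List.getLast?_eq_getLast_of_ne_nil hne] using hb
  subst ha' hb'
  have hp : (Walk.ofSupport l hne hl).IsPath := by
    rw [Walk.isPath_def, Walk.support_ofSupport]
    exact hnd
  intro _
  refine ⟨_, Walk.cons hba (Walk.ofSupport l hne hl), ?_⟩
  rw [Walk.isHamiltonianCycle_iff_isCycle_and_length_eq, Walk.cons_isCycle_iff]
  refine ⟨⟨hp, fun he => ?_⟩, ?_⟩
  · rw [Sym2.eq_swap] at he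
    have := hp.length_eq_one_of_mem_edges he
    rw [Walk.length_ofSupport] at this
    omega
  · rw [Walk.length_cons, Walk.length_ofSupport]
    omega

section Heavy

variable {α β V : Type*} [Fintype V] {G : SimpleGraph V} [DecidableRel G.Adj]
  {X : SimpleGraph α} {Y : SimpleGraph β}

lemma oHeavy_iff_forall_embedding : OHeavy G X ↔ ∀ f : X ↪g G, ∃ i j, f i ≠ f j ∧
    ¬ G.Adj (f i) (f j) ∧ Fintype.card V ≤ G.degree (f i) + G.degree (f j) := by
  constructor
  · intro h f
    obtain ⟨_, _, ⟨i, rfl⟩, ⟨j, rfl⟩, h'⟩ := h _ ⟨f.isoInduceRange⟩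
    exact ⟨i, j, h'⟩
  · rintro h s ⟨e⟩
    obtain ⟨i, j, h'⟩ := h ((Embedding.induce s).comp e.toEmbedding)
    exact ⟨_, _, (e i).2, (e j).2, h'⟩

lemma not_light_of_oHeavy (h : OHeavy G X) : ¬ Light G (heavyClosure G) X := by
  rintro ⟨f, hf⟩
  obtain ⟨i, j, hne, hij, hd⟩ := oHeavy_iff_forall_embedding.1 h f
  exact hij (f.map_adj_iff.2 (hf i j ⟨hne, Or.inr hd⟩))

lemma oHeavy_of_embedding (h : OHeavy G X) (φ : X ↪g Y) : OHeavy G Y := by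
  rw [oHeavy_iff_forall_embedding] at h ⊢
  intro f
  obtain ⟨i, j, h'⟩ := h (f.comp φ)
  exact ⟨_, _, h'⟩

lemma heavyClosure_adj_of_oHeavy_claw (h : OHeavy G clawGraph) {x y₁ y₂ y₃ : V}
    (h₁ : G.Adj x y₁) (h₂ : G.Adj x y₂) (h₃ : G.Adj x y₃) (h₁₂ : y₁ ≠ y₂) (h₁₃ : y₁ ≠ y₃)
    (h₂₃ : y₂ ≠ y₃) : (heavyClosure G).Adj y₁ y₂ ∨ (heavyClosure G).Adj y₁ y₃ ∨
      (heavyClosure G).Adj y₂ y₃ := by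
  by_contra! hno
  obtain ⟨n₁₂, n₁₃, n₂₃⟩ := hno
  have e : ∀ {u v}, G.Adj u v → (heavyClosure G).Adj u v := fun h => le_heavyClosure h
  have a₁₂ := mt e n₁₂
  have a₁₃ := mt e n₁₃
  have a₂₃ := mt e n₂₃
  refine not_light_of_oHeavy h ⟨⟨⟨![x, y₁, y₂, y₃], ?_⟩, ?_⟩, ?_⟩
  · intro i j
    fin_cases i <;> fin_cases j <;>
      simp [h₁.ne, h₂.ne, h₃.ne, h₁.ne', h₂.ne', h₃.ne', h₁₂, h₁₃, h₂₃, h₁₂.symm, h₁₃.symm,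
        h₂₃.symm]
  · intro i j
    change G.Adj (![x, y₁, y₂, y₃] i) (![x, y₁, y₂, y₃] j) ↔ _
    fin_cases i <;> fin_cases j <;>
      simp [clawGraph, h₁, h₂, h₃, h₁.symm, h₂.symm, h₃.symm, a₁₂, a₁₃, a₂₃, G.adj_comm y₃,
        G.adj_comm y₂ y₁]
  · intro i j
    change (heavyClosure G).Adj (![x, y₁, y₂, y₃] i) (![x, y₁, y₂, y₃] j) → _
    fin_cases i <;> fin_cases j <;>
      simp [clawGraph, n₁₂, n₁₃, n₂₃, (heavyClosure G).adj_comm y₃,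
        (heavyClosure G).adj_comm y₂ y₁]

end Heavy

lemma isOneOfLRWZ_embedding {χ : Type*} {X : SimpleGraph χ} (h : IsOneOfLRWZ X) :
    Nonempty (X ↪g netGraph) ∨ Nonempty (X ↪g woundedGraph) := by
  have key : ∀ {α : Type} {Y : SimpleGraph α}, Nonempty (X ≃g Y) →
      Nonempty (Y ↪g woundedGraph) → Nonempty (X ↪g woundedGraph) :=
    fun ⟨e⟩ ⟨f⟩ => ⟨f.comp e.toEmbedding⟩
  rcases h with h | h | h | h | h | h | ⟨⟨e⟩⟩ | ⟨⟨e⟩⟩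
  · refine Or.inr (key h ⟨⟨⟨![3, 0, 1, 4], by decide⟩, ?_⟩⟩)
    simp only [woundedGraph, pathGraph_adj, fromEdgeSet_adj, Set.mem_insert_iff,
      Set.mem_singleton_iff]
    decide
  · refine Or.inr (key h ⟨⟨⟨![3, 0, 1, 4, 5], by decide⟩, ?_⟩⟩)
    simp only [woundedGraph, pathGraph_adj, fromEdgeSet_adj, Set.mem_insert_iff,
      Set.mem_singleton_iff]
    decide
  · refine Or.inr (key h ⟨⟨⟨![0, 1, 2], by decide⟩, ?_⟩⟩)
    simp only [woundedGraph, triangleGraph, fromEdgeSet_adj, Set.mem_insert_iff,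
      Set.mem_singleton_iff]
    decide
  · refine Or.inr (key h ⟨⟨⟨![2, 1, 0, 3], by decide⟩, ?_⟩⟩)
    simp only [woundedGraph, Z1, fromEdgeSet_adj, Set.mem_insert_iff, Set.mem_singleton_iff]
    decide
  · refine Or.inr (key h ⟨⟨⟨![0, 2, 1, 4, 5], by decide⟩, ?_⟩⟩)
    simp only [woundedGraph, Z2, fromEdgeSet_adj, Set.mem_insert_iff, Set.mem_singleton_iff]
    decide
  · refine Or.inr (key h ⟨⟨⟨![0, 1, 2, 3, 4], by decide⟩, ?_⟩⟩)
    simp only [woundedGraph, bullGraph, fromEdgeSet_adj, Set.mem_insert_iff, Set.mem_singleton_iff]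
    decide
  · exact Or.inl ⟨e.toEmbedding⟩
  · exact Or.inr ⟨e.toEmbedding⟩

lemma isHamiltonian_of_oHeavy {α β V : Type*} [Fintype V] [DecidableEq V] {R : SimpleGraph α}
    {S : SimpleGraph β} {G : SimpleGraph V} [DecidableRel G.Adj]
    (hR : Nonempty (R ≃g clawGraph)) (hS : IsOneOfLRWZ S) (hG : TwoConnected G)
    (hGR : OHeavy G R) (hGS : OHeavy G S) : G.IsHamiltonian := by
  have hclaw : OHeavy G clawGraph := oHeavy_of_embedding hGR hR.some.toEmbedding
  obtain ⟨C, a, b, hC, hba, hnd, hmem⟩ := exists_cycle_of_light hG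
    (fun x y₁ y₂ y₃ h₁ h₂ h₃ => heavyClosure_adj_of_oHeavy_claw hclaw h₁ h₂ h₃)
    ((isOneOfLRWZ_embedding hS).imp (fun ⟨φ⟩ => not_light_of_oHeavy (oHeavy_of_embedding hGS φ))
      (fun ⟨φ⟩ => not_light_of_oHeavy (oHeavy_of_embedding hGS φ)))
  exact isHamiltonian_of_pathOn hC hba hnd hmem hG.1

section BoolGraph

/-- The symmetric irreflexive Boolean relation generated by `a`. -/
def adjB (a : ℕ → ℕ → Bool) (x y : ℕ) : Bool := x != y && (a x y || a y x)

lemma adjB_comm (a : ℕ → ℕ → Bool) (x y : ℕ) : adjB a x y = adjB a y x := by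
  simp [adjB, Bool.or_comm, bne_comm (a := x)]

/-- The graph on `Fin n` generated by the Boolean relation `a`. -/
def boolGraph (n : ℕ) (a : ℕ → ℕ → Bool) : SimpleGraph (Fin n) where
  Adj i j := adjB a i j = true
  symm := ⟨fun i j h => by rwa [adjB_comm]⟩
  loopless := ⟨fun i h => by simp [adjB] at h⟩

instance (n : ℕ) (a : ℕ → ℕ → Bool) : DecidableRel (boolGraph n a).Adj :=
  fun i j => inferInstanceAs (Decidable (adjB a i j = true))

lemma boolGraph_adj {n : ℕ} {a : ℕ → ℕ → Bool} {i j : Fin n} :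
    (boolGraph n a).Adj i j ↔ adjB a i j = true := Iff.rfl

/-- The graph with vertices `0, …, p.1 - 1` and edge list `p.2`. -/
def edgeGraph (p : ℕ × List (ℕ × ℕ)) : SimpleGraph (Fin p.1) :=
  boolGraph p.1 fun i j => p.2.contains (i, j)

/-- Backtracking search: can `f 0, …, f (j - 1)` be extended by `m` further elements of `l` so
that the pairs related by `x` satisfy `T` and the other pairs satisfy `F`? -/
def findCopy (T F x : ℕ → ℕ → Bool) (l : List ℕ) : ℕ → ℕ → (ℕ → ℕ) → Bool
  | 0, _, _ => true
  | m + 1, j, f => l.any fun v =>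
      (List.range j).all (fun i => bif x j i then T v (f i) else F v (f i)) &&
        findCopy T F x l m (j + 1) fun i => bif i == j then v else f i

lemma findCopy_iff {T F x : ℕ → ℕ → Bool} {l : List ℕ} {m j : ℕ} {f : ℕ → ℕ} :
    findCopy T F x l m j f = true ↔ ∃ g : ℕ → ℕ, (∀ i < j, g i = f i) ∧
      ∀ i, j ≤ i → i < j + m → g i ∈ l ∧
        ∀ i' < i, (bif x i i' then T (g i) (g i') else F (g i) (g i')) = true := by
  induction m generalizing j f with
  | zero =>
    simp only [findCopy, true_iff]
    exact ⟨f, fun _ _ => rfl, fun i h₁ h₂ => by omega⟩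
  | succ m ih =>
    simp only [findCopy, List.any_eq_true, Bool.and_eq_true, List.all_eq_true, List.mem_range, ih]
    constructor
    · rintro ⟨v, hv, hvf, g, hg, h⟩
      have hgj : g j = v := by simpa using hg j (by omega)
      have hgi : ∀ i < j, g i = f i := fun i hi => by
        simpa [beq_false_of_ne hi.ne] using hg i (by omega)
      refine ⟨g, hgi, fun i h₁ h₂ => ?_⟩
      rcases h₁.eq_or_lt with rfl | h₁
      · refine ⟨hgj ▸ hv, fun i' hi' => ?_⟩
        rw [hgj, hgi i' hi']
        exact hvf i' hi'
      · exact h i h₁ (by omega)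
    · rintro ⟨g, hg, h⟩
      obtain ⟨h₁, h₂⟩ := h j le_rfl (by omega)
      refine ⟨g j, h₁, fun i hi => ?_, g, fun i hi => ?_, fun i h₃ h₄ =>
        h i (by omega) (by omega)⟩
      · rw [← hg i hi]
        exact h₂ i hi
      · by_cases hij : i = j
        · simp [hij]
        · simpa [beq_false_of_ne hij] using hg i (by omega)

variable {n k : ℕ} {a x h : ℕ → ℕ → Bool} {l : List ℕ}

/-- The pairs of distinct, nonadjacent vertices that are not marked by `h`. -/
def lightB (a h : ℕ → ℕ → Bool) (u v : ℕ) : Bool := u != v && !adjB a u v && !h u v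

lemma findCopy_of_embedding (f : boolGraph k x ↪g boolGraph n a) (hl : ∀ i, (f i : ℕ) ∈ l)
    (hf : ∀ i j, h (f i) (f j) = false) :
    findCopy (adjB a) (lightB a h) (adjB x) l k 0 id = true := by
  rw [findCopy_iff]
  refine ⟨fun i => if hi : i < k then f ⟨i, hi⟩ else 0, by simp, fun i _ hi => ?_⟩
  rw [zero_add] at hi
  refine ⟨by simpa [hi] using hl ⟨i, hi⟩, fun i' hi' => ?_⟩
  have hik : i' < k := hi'.trans hi
  simp only [hi, hik, dite_true]
  have key := f.map_adj_iff (v := ⟨i, hi⟩) (w := ⟨i', hik⟩)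
  have hne : (f ⟨i, hi⟩ : ℕ) ≠ f ⟨i', hik⟩ := fun e => by
    have := f.injective (Fin.ext e)
    simp only [Fin.mk.injEq] at this
    omega
  simp only [boolGraph_adj] at key
  cases hx : adjB x i i' with
  | true => simpa [hx] using key
  | false =>
    rw [hx] at key
    simp [lightB, hf, hne]
    simpa using key

lemma exists_embedding_of_findCopy (hl : ∀ v ∈ l, v < n)
    (hc : findCopy (adjB a) (lightB a h) (adjB x) l k 0 id = true) :
    ∃ f : boolGraph k x ↪g boolGraph n a, ∀ i, (f i : ℕ) ∈ l := by
  obtain ⟨g, -, hg⟩ := findCopy_iff.1 hc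
  have hg₁ : ∀ i < k, g i ∈ l := fun i hi => (hg i (by omega) (by omega)).1
  have hlt : ∀ i < k, ∀ i' < i, g i ≠ g i' ∧ (adjB a (g i) (g i') = adjB x i i') := by
    intro i hi i' hi'
    have := (hg i (by omega) (by omega)).2 i' hi'
    cases hx : adjB x i i' with
    | true =>
      simp only [hx, cond_true] at this
      refine ⟨fun e => ?_, this⟩
      rw [e] at this
      simp [adjB] at this
    | false =>
      simp only [hx, cond_false, lightB, Bool.and_eq_true, bne_iff_ne, ne_eq, Bool.not_eq_true']
        at this
      exact this.1
  have hinj : ∀ i j : Fin k, g i = g j → i = j := by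
    intro i j e
    rcases lt_trichotomy i.1 j.1 with hij | hij | hij
    · exact absurd e.symm (hlt j j.2 i hij).1
    · exact Fin.ext hij
    · exact absurd e (hlt i i.2 j hij).1
  refine ⟨⟨⟨fun i => ⟨g i, hl _ (hg₁ i i.2)⟩, fun i j e => hinj i j (by simpa using e)⟩, ?_⟩,
    fun i => hg₁ i i.2⟩
  intro i j
  change adjB a (g i) (g j) = true ↔ adjB x i j = true
  rcases lt_trichotomy i.1 j.1 with hij | hij | hij
  · rw [adjB_comm a, adjB_comm x, (hlt j j.2 i hij).2]
  · rw [hij]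
    simp [adjB]
  · rw [(hlt i i.2 j hij).2]

end BoolGraph

section Check

variable {β : Type*} {S : SimpleGraph β} {n : ℕ} {a h : ℕ → ℕ → Bool} {l : List ℕ}
  {P Q : List (ℕ × List (ℕ × ℕ))}

/-- Add to `r` the elements of `l` that have a neighbour in `r`. -/
def grow (a : ℕ → ℕ → Bool) (l r : List ℕ) : List ℕ :=
  l.filter fun y => r.contains y || r.any (adjB a y)

/-- Is `r` a set of vertices in `l`, closed under adjacency, that misses a vertex of `l`? -/
def separates (a : ℕ → ℕ → Bool) (l r : List ℕ) : Bool :=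
  r.any l.contains && l.any (fun y => !r.contains y) &&
    l.all fun y => r.contains y || !r.any (adjB a y)

/-- A vertex set `l` is classified if it is disconnected, has fewer than three vertices, contains
a pair marked by `h`, induces a graph listed in `P`, or contains an induced graph listed
in `Q`. -/
def classified (a h : ℕ → ℕ → Bool) (P Q : List (ℕ × List (ℕ × ℕ))) (l : List ℕ) : Bool :=
  separates a l ((grow a l)^[8] (l.take 1)) || decide (l.length < 3) ||
    l.any (fun u => l.any (h u)) ||
    P.any (fun p => p.1 == l.length && findCopy (adjB a) (lightB a h)
      (adjB fun i j => p.2.contains (i, j)) l p.1 0 id) ||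
    Q.any fun p => findCopy (adjB a) (lightB a h)
      (adjB fun i j => p.2.contains (i, j)) l p.1 0 id

lemma nonempty_embedding_of_mem_range (f : S ↪g boolGraph n a) {α : Type*} {X : SimpleGraph α}
    (g : X ↪g boolGraph n a) (hg : ∀ i, ∃ b, f b = g i) : ∃ φ : X ↪g S, ∀ i, f (φ i) = g i := by
  choose φ hφ using hg
  refine ⟨⟨⟨φ, fun i j e => g.injective (by rw [← hφ, ← hφ, e])⟩, ?_⟩, hφ⟩
  intro i j
  change S.Adj (φ i) (φ j) ↔ _
  rw [← f.map_adj_iff, hφ, hφ, g.map_adj_iff]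

lemma exists_of_classified [Fintype β] (hS : S.Connected) (hcard : 3 ≤ Fintype.card β)
    (f : S ↪g boolGraph n a) (hf : ∀ i j, h (f i) (f j) = false)
    (hc : ∀ l ∈ (List.range n).sublists, classified a h P Q l = true) :
    (∃ p ∈ P, Nonempty (S ≃g edgeGraph p)) ∨ ∃ p ∈ Q, Nonempty (edgeGraph p ↪g S) := by
  classical
  set l : List ℕ := (List.range n).filter fun i => decide (∃ b, (f b : ℕ) = i) with hl
  have hmem : ∀ i, i ∈ l ↔ ∃ b, (f b : ℕ) = i := by
    intro i
    simp only [hl, List.mem_filter, List.mem_range, decide_eq_true_eq, and_iff_right_iff_imp]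
    rintro ⟨b, rfl⟩
    exact (f b).2
  have hln : ∀ i ∈ l, i < n := by
    intro i hi
    obtain ⟨b, rfl⟩ := (hmem i).1 hi
    exact (f b).2
  have hlen : l.length = Fintype.card β := by
    have hnd : l.Nodup := List.nodup_range.filter _
    rw [← List.toFinset_card_of_nodup hnd, ← Finset.card_univ,
      ← Finset.card_image_of_injective Finset.univ
        (Fin.val_injective.comp f.injective : Function.Injective fun b => (f b : ℕ))]
    congr 1
    ext i
    simp [hmem]
  have hrange : ∀ {α : Type} {X : SimpleGraph α} (g : X ↪g boolGraph n a),
      (∀ i, (g i : ℕ) ∈ l) → ∃ φ : X ↪g S, ∀ i, f (φ i) = g i := by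
    intro α X g hg
    refine nonempty_embedding_of_mem_range f g fun i => ?_
    obtain ⟨b, hb⟩ := (hmem _).1 (hg i)
    exact ⟨b, Fin.ext hb⟩
  have := hc l (List.mem_sublists.2 List.filter_sublist)
  simp only [classified, Bool.or_eq_true, decide_eq_true_eq, List.any_eq_true, Bool.and_eq_true,
    beq_iff_eq] at this
  rcases this with (((hsep | hlt) | ⟨u, hu, v, hv, huv⟩) | ⟨p, hp, hpl, hpc⟩) | ⟨p, hp, hpc⟩
  · generalize (grow a l)^[8] (l.take 1) = r at hsep
    simp only [separates, Bool.and_eq_true, List.any_eq_true, List.contains_iff_mem,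
      Bool.not_eq_true', List.all_eq_true, Bool.or_eq_true] at hsep
    obtain ⟨⟨⟨u, hur, hul⟩, v, hvl, hvr⟩, hcl⟩ := hsep
    exfalso
    obtain ⟨b, rfl⟩ := (hmem u).1 hul
    obtain ⟨c, rfl⟩ := (hmem v).1 hvl
    have : ∀ c, Relation.ReflTransGen S.Adj b c → (f c : ℕ) ∈ r := by
      intro c hbc
      induction hbc with
      | refl => exact hur
      | tail _ hadj ih =>
        rcases hcl _ ((hmem _).2 ⟨_, rfl⟩) with h' | h'
        · exact h'
        · rw [List.any_eq_false] at h'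
          have h₂ := h' _ ih
          have h₃ := f.map_adj_iff.2 hadj.symm
          rw [boolGraph_adj] at h₃
          exact absurd h₃ h₂
    have := this c ((reachable_iff_reflTransGen b c).1 (hS.preconnected b c))
    simp [this] at hvr
  · omega
  · obtain ⟨b, rfl⟩ := (hmem u).1 hu
    obtain ⟨c, rfl⟩ := (hmem v).1 hv
    rw [hf] at huv
    cases huv
  · obtain ⟨g, hg⟩ := exists_embedding_of_findCopy hln hpc
    obtain ⟨φ, -⟩ := hrange g hg
    have hb : Function.Bijective φ := by
      rw [Fintype.bijective_iff_injective_and_card]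
      exact ⟨φ.injective, by simp [hpl, hlen]⟩
    exact Or.inl ⟨p, hp, ⟨(RelIso.ofSurjective φ hb.2).symm⟩⟩
  · obtain ⟨g, hg⟩ := exists_embedding_of_findCopy hln hpc
    obtain ⟨φ, -⟩ := hrange g hg
    exact Or.inr ⟨p, hp, ⟨φ⟩⟩

end Check

section Nonhamiltonian

variable {V : Type*} {G : SimpleGraph V}

lemma reflTransGen_toSubgraph {u v w : V} (p : G.Walk u v) (hw : w ∈ p.support) :
    Relation.ReflTransGen p.toSubgraph.Adj u w := by
  induction p with
  | nil =>
    rw [Walk.support_nil, List.mem_singleton] at hw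
    rw [hw]
  | cons h p ih =>
    rw [Walk.support_cons, List.mem_cons] at hw
    rcases hw with rfl | hw
    · exact .refl
    · have hle : p.toSubgraph.Adj ≤ (Walk.cons h p).toSubgraph.Adj := fun _ _ h' => Or.inr h'
      exact .head (Or.inl rfl) (Relation.ReflTransGen.mono hle _ _ (ih hw))

lemma exists_cycle_relation [Fintype V] [DecidableEq V] (hG : G.IsHamiltonian)
    (hcard : 3 ≤ Fintype.card V) :
    ∃ D : V → V → Prop, (∀ u v, D u v → D v u) ∧ (∀ u v, D u v → G.Adj u v) ∧
      (∀ u, ∃ x y, x ≠ y ∧ ∀ z, D u z ↔ z = x ∨ z = y) ∧ ∀ u v, Relation.ReflTransGen D u v := by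
  obtain ⟨a, p, hp⟩ := hG (by omega)
  have : Std.Symm p.toSubgraph.Adj := ⟨fun _ _ h => h.symm⟩
  refine ⟨p.toSubgraph.Adj, fun _ _ h => h.symm, fun _ _ h => h.adj_sub, fun u => ?_, fun u v => ?_⟩
  · have := hp.isCycle.ncard_neighborSet_toSubgraph_eq_two (hp.mem_support u)
    obtain ⟨x, y, hxy, h⟩ := Set.ncard_eq_two.1 this
    refine ⟨x, y, hxy, fun z => ?_⟩
    rw [← Subgraph.mem_neighborSet, h]
    simp
  · exact (Std.Symm.symm _ _ (reflTransGen_toSubgraph p (hp.mem_support u))).trans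
      (reflTransGen_toSubgraph p (hp.mem_support v))

/-- A graph with three vertices whose only neighbours are two given vertices is not
hamiltonian. -/
lemma not_isHamiltonian_of_three_common [Fintype V] [DecidableEq V] {u v x y z : V}
    (hx : ∀ w, G.Adj x w → w = u ∨ w = v) (hy : ∀ w, G.Adj y w → w = u ∨ w = v)
    (hz : ∀ w, G.Adj z w → w = u ∨ w = v) (hxy : x ≠ y) (hxz : x ≠ z) (hyz : y ≠ z) :
    ¬ G.IsHamiltonian := by
  intro hG
  have hcard : 3 ≤ Fintype.card V := by
    rw [← Finset.card_univ, ← Finset.card_eq_three.2 ⟨x, y, z, hxy, hxz, hyz, rfl⟩]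
    exact Finset.card_le_univ _
  obtain ⟨D, hsymm, hD, htwo, -⟩ := exists_cycle_relation hG hcard
  have key : ∀ w, (∀ t, G.Adj w t → t = u ∨ t = v) → D u w := by
    intro w hw
    obtain ⟨s, t, hst, h⟩ := htwo w
    have hs := hw s (hD w s ((h s).2 (Or.inl rfl)))
    have ht := hw t (hD w t ((h t).2 (Or.inr rfl)))
    refine hsymm _ _ ((h u).2 ?_)
    grind
  obtain ⟨s, t, -, h⟩ := htwo u
  have h₁ := (h x).1 (key x hx)
  have h₂ := (h y).1 (key y hy)
  have h₃ := (h z).1 (key z hz)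
  grind

/-- Three triangles `A i`, `B i`, `C i` with `C i` of degree two and no further edges at `B i`
except those of the triangle `B 0`, `B 1`, `B 2` obstruct a Hamilton cycle. -/
lemma not_isHamiltonian_of_three_triangles [Fintype V] [DecidableEq V] {A B C : Fin 3 → V}
    (hC : ∀ i w, G.Adj (C i) w → w = A i ∨ w = B i)
    (hB : ∀ i w, G.Adj (B i) w → w = A i ∨ w = C i ∨ w = B (i + 1) ∨ w = B (i + 2))
    (hBB : B.Injective) (hAB : ∀ i j, A i ≠ B j) (hCB : ∀ i j, C i ≠ B j) :
    ¬ G.IsHamiltonian := by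
  intro hG
  have hcard : 3 ≤ Fintype.card V := by simpa using Fintype.card_le_of_injective B hBB
  obtain ⟨D, hsymm, hD, htwo, hconn⟩ := exists_cycle_relation hG hcard
  have hCD : ∀ i, ∀ w, D (C i) w ↔ w = A i ∨ w = B i := by
    intro i w
    obtain ⟨s, t, hst, h⟩ := htwo (C i)
    have hs := hC i s (hD _ s ((h s).2 (Or.inl rfl)))
    have ht := hC i t (hD _ t ((h t).2 (Or.inr rfl)))
    rw [h]
    grind
  have hno : ∀ i, ¬ D (A i) (B i) := by
    intro i hi
    have hcl : ∀ w, Relation.ReflTransGen D (A i) w → w = A i ∨ w = B i ∨ w = C i := by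
      intro w hw
      induction hw with
      | refl => exact Or.inl rfl
      | @tail v w _ hvw ih =>
        have hCA := hsymm _ _ ((hCD i _).2 (Or.inl rfl))
        have hCB' := hsymm _ _ ((hCD i _).2 (Or.inr rfl))
        have hBC := hCB i i
        have hAC : A i ≠ C i := (hD _ _ hCA).ne
        have hBA := hAB i i
        rcases ih with rfl | rfl | rfl
        · obtain ⟨s, t, hst, h⟩ := htwo (A i)
          have := (h _).1 hvw
          have := (h _).1 hi
          have := (h _).1 hCA
          grind
        · obtain ⟨s, t, hst, h⟩ := htwo (B i)
          have := (h _).1 hvw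
          have := (h _).1 (hsymm _ _ hi)
          have := (h _).1 hCB'
          grind
        · have := (hCD i w).1 hvw
          tauto
    have hne : B (i + 1) ≠ B i := hBB.ne (by simp)
    rcases hcl _ (hconn _ (B (i + 1))) with h | h | h
    · exact hAB _ _ h.symm
    · exact hne h
    · exact hCB _ _ h.symm
  have hxor : ∀ i, (D (B i) (B (i + 1)) ↔ ¬ D (B i) (B (i + 2))) := by
    intro i
    obtain ⟨s, t, hst, h⟩ := htwo (B i)
    have hBC := hsymm _ _ ((hCD i _).2 (Or.inr rfl))
    have hs := hB i s (hD _ s ((h s).2 (Or.inl rfl)))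
    have ht := hB i t (hD _ t ((h t).2 (Or.inr rfl)))
    have hA := mt (hsymm _ _) (hno i)
    have h₁₂ : B (i + 1) ≠ B (i + 2) := hBB.ne (by simp)
    have h₁ := hCB i (i + 1)
    have h₂ := hCB i (i + 2)
    rw [h] at hBC hA
    rw [h, h]
    grind
  have h₀ := hxor 0
  have h₁ := hxor 1
  have h₂ := hxor 2
  have c₀₁ : D (B 0) (B 1) ↔ D (B 1) (B 0) := ⟨hsymm _ _, hsymm _ _⟩
  have c₀₂ : D (B 0) (B 2) ↔ D (B 2) (B 0) := ⟨hsymm _ _, hsymm _ _⟩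
  have c₁₂ : D (B 1) (B 2) ↔ D (B 2) (B 1) := ⟨hsymm _ _, hsymm _ _⟩
  simp only [show (0 : Fin 3) + 1 = 1 from rfl, show (0 : Fin 3) + 2 = 2 from rfl,
    show (1 : Fin 3) + 1 = 2 from rfl, show (1 : Fin 3) + 2 = 0 from rfl,
    show (2 : Fin 3) + 1 = 0 from rfl, show (2 : Fin 3) + 2 = 1 from rfl] at h₀ h₁ h₂
  tauto

end Nonhamiltonian

lemma twoConnected_boolGraph {n : ℕ} {a : ℕ → ℕ → Bool} (hn : 3 ≤ n)
    (h : ∀ v < n, ∀ y < n, y ≠ v → y ∈ (grow a ((List.range n).filter (· != v)))^[8]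
      [if v = 0 then 1 else 0]) : TwoConnected (boolGraph n a) := by
  refine ⟨by simpa using hn, fun v => ?_⟩
  set G' := (boolGraph n a).induce ({v}ᶜ : Set (Fin n)) with hG'
  obtain ⟨r, hr⟩ : ∃ r : ({v}ᶜ : Set (Fin n)), (r : ℕ) = if (v : ℕ) = 0 then 1 else 0 := by
    refine ⟨⟨⟨if (v : ℕ) = 0 then 1 else 0, by split <;> omega⟩, fun e => ?_⟩, rfl⟩
    have := congrArg Fin.val (Set.mem_singleton_iff.1 e)
    simp only at this
    split at this <;> omega
  have key : ∀ k, ∀ y ∈ (grow a ((List.range n).filter (· != (v : ℕ))))^[k] [(r : ℕ)],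
      ∃ y' : ({v}ᶜ : Set (Fin n)), (y' : ℕ) = y ∧ G'.Reachable r y' := by
    intro k
    induction k with
    | zero =>
      intro y hy
      exact ⟨r, (List.mem_singleton.1 hy).symm, .refl _⟩
    | succ k ih =>
      intro y hy
      rw [Function.iterate_succ_apply'] at hy
      generalize (grow a ((List.range n).filter (· != (v : ℕ))))^[k] [(r : ℕ)] = R at hy ih
      simp only [grow, List.mem_filter, List.mem_range, bne_iff_ne, ne_eq, Bool.or_eq_true,
        List.contains_iff_mem, List.any_eq_true] at hy
      obtain ⟨⟨hyn, hyv⟩, hyR | ⟨z, hz, hzy⟩⟩ := hy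
      · exact ih y hyR
      · obtain ⟨z', rfl, hz'⟩ := ih z hz
        refine ⟨⟨⟨y, hyn⟩, fun e => hyv (congrArg Fin.val (Set.mem_singleton_iff.1 e))⟩, rfl,
          hz'.trans (Adj.reachable ?_)⟩
        rw [hG', induce_adj, boolGraph_adj, adjB_comm]
        exact hzy
  refine (connected_iff_exists_forall_reachable G').2 ⟨r, fun y => ?_⟩
  have hy := h v v.2 y y.1.2 fun e => y.2 (Fin.ext e)
  rw [← hr] at hy
  obtain ⟨y', hy', hry⟩ := key 8 y hy
  rwa [Subtype.ext (Fin.ext hy')] at hry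

section Hosts

/-- `K_{2,3}` with classes `{0, 1}` and `{2, 3, 4}`. -/
def bipartiteB (x y : ℕ) : Bool := decide (x < 2) && decide (2 ≤ y)

/-- Triangles `0 1 2` and `6 7 8` joined by the paths `i`, `i + 3`, `i + 6`. -/
def threePathsB (x y : ℕ) : Bool :=
  (x % 3 == y % 3 && x / 3 + 1 == y / 3) || (x / 3 == y / 3 && x / 3 != 1)

/-- Triangles `0 1 2` and `6 7 8` joined by the triangles `i`, `i + 3`, `i + 6`. -/
def threeTrianglesB (x y : ℕ) : Bool :=
  x % 3 == y % 3 || (x / 3 == y / 3 && x / 3 != 1)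

/-- The triangle `6 7 8`, the triangles `i`, `i + 3`, `i + 6`, and a complete graph on
`9, …, 13` whose vertices are all adjacent to `0`, `1` and `2`. -/
def completeHubB (x y : ℕ) : Bool :=
  (decide (x < 9) && decide (y < 9) && (x % 3 == y % 3 || (x / 3 == 2 && y / 3 == 2))) ||
    (decide (9 ≤ y) && (decide (x < 3) || decide (9 ≤ x)))

/-- The pairs of distinct vertices below `m`. -/
def belowB (m x y : ℕ) : Bool := decide (x < m) && decide (y < m) && x != y

variable {α : Type*} {X : SimpleGraph α}

lemma exists_embedding_of_not_oHeavy {n m d : ℕ} {a : ℕ → ℕ → Bool}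
    (hX : ¬ OHeavy (boolGraph n a) X) (hd : ∀ i : Fin n, (i : ℕ) < m → (boolGraph n a).degree i = d)
    (hnd : n ≤ d + d) (hm : ∀ i : Fin n, (i : ℕ) < m → ∀ j : Fin n, (j : ℕ) < m →
      adjB a i j = false) :
    ∃ f : X ↪g boolGraph n a, ∀ i j, belowB m (f i) (f j) = false := by
  rw [oHeavy_iff_forall_embedding] at hX
  push Not at hX
  obtain ⟨f, hf⟩ := hX
  refine ⟨f, fun i j => ?_⟩
  by_contra h
  simp only [belowB, Bool.not_eq_false, Bool.and_eq_true, decide_eq_true_eq, bne_iff_ne, ne_eq,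
    Fin.val_inj] at h
  have h₁ := hf i j h.2 (by simp [boolGraph_adj, hm _ h.1.1 _ h.1.2])
  rw [hd _ h.1.1, hd _ h.1.2, Fintype.card_fin] at h₁
  omega

lemma not_isHamiltonian_bipartite : ¬ (boolGraph 5 bipartiteB).IsHamiltonian :=
  not_isHamiltonian_of_three_common (u := 0) (v := 1) (x := 2) (y := 3) (z := 4) (by decide)
    (by decide) (by decide) (by decide) (by decide) (by decide)

lemma not_isHamiltonian_threePaths : ¬ (boolGraph 9 threePathsB).IsHamiltonian :=
  not_isHamiltonian_of_three_triangles (A := ![0, 1, 2]) (C := ![3, 4, 5]) (B := ![6, 7, 8])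
    (by decide +kernel) (by decide +kernel) (by decide) (by decide) (by decide)

lemma not_isHamiltonian_threeTriangles : ¬ (boolGraph 9 threeTrianglesB).IsHamiltonian :=
  not_isHamiltonian_of_three_triangles (A := ![0, 1, 2]) (C := ![3, 4, 5]) (B := ![6, 7, 8])
    (by decide +kernel) (by decide +kernel) (by decide) (by decide) (by decide)

lemma not_isHamiltonian_completeHub : ¬ (boolGraph 14 completeHubB).IsHamiltonian :=
  not_isHamiltonian_of_three_triangles (A := ![0, 1, 2]) (C := ![3, 4, 5]) (B := ![6, 7, 8])
    (by decide +kernel) (by decide +kernel) (by decide) (by decide) (by decide)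

lemma twoConnected_bipartite : TwoConnected (boolGraph 5 bipartiteB) :=
  twoConnected_boolGraph (by decide) (by decide +kernel)

lemma twoConnected_threePaths : TwoConnected (boolGraph 9 threePathsB) :=
  twoConnected_boolGraph (by decide) (by decide +kernel)

lemma twoConnected_threeTriangles : TwoConnected (boolGraph 9 threeTrianglesB) :=
  twoConnected_boolGraph (by decide) (by decide +kernel)

lemma twoConnected_completeHub : TwoConnected (boolGraph 14 completeHubB) :=
  twoConnected_boolGraph (by decide) (by decide +kernel)

end Hosts

section Patterns

/-- The path on three vertices. -/
def p3Data : ℕ × List (ℕ × ℕ) := (3, [(0, 1), (1, 2)])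

/-- The claw. -/
def clawData : ℕ × List (ℕ × ℕ) := (4, [(0, 1), (0, 2), (0, 3)])

/-- The graphs `P₄`, `P₅`, `C₃`, `Z₁`, `Z₂`, `B`, `N` and `W`. -/
def lrwzData : List (ℕ × List (ℕ × ℕ)) :=
  [(4, [(0, 1), (1, 2), (2, 3)]), (5, [(0, 1), (1, 2), (2, 3), (3, 4)]),
    (3, [(0, 1), (1, 2), (0, 2)]), (4, [(0, 1), (0, 2), (1, 2), (2, 3)]),
    (5, [(0, 1), (0, 2), (1, 2), (2, 3), (3, 4)]), (5, [(0, 1), (0, 2), (1, 2), (0, 3), (1, 4)]),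
    (6, [(0, 1), (0, 2), (1, 2), (0, 3), (1, 4), (2, 5)]),
    (6, [(0, 1), (0, 2), (1, 2), (0, 3), (1, 4), (4, 5)])]

/-- The path on six vertices. -/
def p6Data : ℕ × List (ℕ × ℕ) := (6, [(0, 1), (1, 2), (2, 3), (3, 4), (4, 5)])

/-- A triangle with a pendant path of length three, a triangle with pendant paths of lengths
one, one and two, and the cycle of length six. -/
def otherData : List (ℕ × List (ℕ × ℕ)) :=
  [(6, [(0, 1), (0, 2), (1, 2), (2, 3), (3, 4), (4, 5)]),
    (7, [(0, 1), (0, 2), (1, 2), (0, 3), (1, 4), (2, 5), (4, 6)]),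
    (6, [(0, 1), (1, 2), (2, 3), (3, 4), (4, 5), (0, 5)])]

lemma classified_bipartite : ∀ l ∈ (List.range 5).sublists,
    classified bipartiteB (belowB 2) [p3Data, clawData] [] l = true := by
  decide +kernel

lemma classified_threePaths : ∀ l ∈ (List.range 9).sublists,
    classified threePathsB (belowB 0) (p3Data :: lrwzData) (p6Data :: otherData) l = true := by
  decide +kernel

end Patterns

section Necessity

lemma oHeavy_edgeGraph_of_findCopy {n m d : ℕ} {a : ℕ → ℕ → Bool} {p : ℕ × List (ℕ × ℕ)}
    (hd : ∀ i : Fin n, (i : ℕ) < m → (boolGraph n a).degree i = d)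
    (hnd : n ≤ d + d) (hm : ∀ i : Fin n, (i : ℕ) < m → ∀ j : Fin n, (j : ℕ) < m →
      adjB a i j = false)
    (hc : findCopy (adjB a) (lightB a (belowB m)) (adjB fun i j => p.2.contains (i, j))
      (List.range n) p.1 0 id = false) : OHeavy (boolGraph n a) (edgeGraph p) := by
  by_contra hX
  obtain ⟨f, hf⟩ := exists_embedding_of_not_oHeavy hX hd hnd hm
  have := findCopy_of_embedding f (fun i => List.mem_range.2 (f i).2) hf
  rw [hc] at this
  cases this

lemma oHeavy_threePaths_claw : OHeavy (boolGraph 9 threePathsB) (edgeGraph clawData) :=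
  oHeavy_edgeGraph_of_findCopy (m := 0) (d := 9) (by simp) (by simp) (by simp) (by decide +kernel)

lemma oHeavy_threeTriangles {p : ℕ × List (ℕ × ℕ)} (hp : p ∈ clawData :: otherData) :
    OHeavy (boolGraph 9 threeTrianglesB) (edgeGraph p) := by
  refine oHeavy_edgeGraph_of_findCopy (m := 0) (d := 9) (by simp) (by simp) (by simp) ?_
  revert p
  decide +kernel

lemma oHeavy_completeHub {p : ℕ × List (ℕ × ℕ)} (hp : p ∈ [clawData, p6Data]) :
    OHeavy (boolGraph 14 completeHubB) (edgeGraph p) := by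
  refine oHeavy_edgeGraph_of_findCopy (m := 3) (d := 7) (by decide +kernel) (by simp)
    (by decide +kernel) ?_
  revert p
  decide +kernel

lemma nonempty_iso_of_adjB {χ : Type*} {X : SimpleGraph χ} {k : ℕ} {es : List (ℕ × ℕ)}
    {Y : SimpleGraph (Fin k)} (e : X ≃g edgeGraph (k, es))
    (h : ∀ i j : Fin k, adjB (fun i j => es.contains (i, j)) i j = true ↔ Y.Adj i j) :
    Nonempty (X ≃g Y) := by
  have hY : Y = edgeGraph (k, es) := by
    ext i j
    exact (h i j).symm
  exact hY ▸ ⟨e⟩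

lemma nonempty_iso_pathGraph_three {χ : Type*} {X : SimpleGraph χ} (e : X ≃g edgeGraph p3Data) :
    Nonempty (X ≃g pathGraph 3) := by
  refine nonempty_iso_of_adjB e ?_
  simp only [pathGraph_adj]
  decide

lemma nonempty_iso_clawGraph {χ : Type*} {X : SimpleGraph χ} (e : X ≃g edgeGraph clawData) :
    Nonempty (X ≃g clawGraph) := by
  refine nonempty_iso_of_adjB e ?_
  simp only [clawGraph, fromEdgeSet_adj, Set.mem_insert_iff, Set.mem_singleton_iff]
  decide

lemma nonempty_clawGraph_iso : Nonempty (edgeGraph clawData ≃g clawGraph) :=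
  nonempty_iso_clawGraph .refl

lemma isOneOfLRWZ_of_iso {χ : Type*} {X : SimpleGraph χ} {p : ℕ × List (ℕ × ℕ)}
    (hp : p ∈ lrwzData) (e : X ≃g edgeGraph p) : IsOneOfLRWZ X := by
  simp only [lrwzData, List.mem_cons, List.not_mem_nil, or_false] at hp
  rcases hp with rfl | rfl | rfl | rfl | rfl | rfl | rfl | rfl
  · refine .inl (nonempty_iso_of_adjB e ?_)
    simp only [pathGraph_adj]
    decide
  · refine .inr (.inl (nonempty_iso_of_adjB e ?_))
    simp only [pathGraph_adj]
    decide
  · refine .inr (.inr (.inl (nonempty_iso_of_adjB e ?_)))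
    simp only [triangleGraph, fromEdgeSet_adj, Set.mem_insert_iff, Set.mem_singleton_iff]
    decide
  · refine .inr (.inr (.inr (.inl (nonempty_iso_of_adjB e ?_))))
    simp only [Z1, fromEdgeSet_adj, Set.mem_insert_iff, Set.mem_singleton_iff]
    decide
  · refine .inr (.inr (.inr (.inr (.inl (nonempty_iso_of_adjB e ?_)))))
    simp only [Z2, fromEdgeSet_adj, Set.mem_insert_iff, Set.mem_singleton_iff]
    decide
  · refine .inr (.inr (.inr (.inr (.inr (.inl (nonempty_iso_of_adjB e ?_))))))
    simp only [bullGraph, fromEdgeSet_adj, Set.mem_insert_iff, Set.mem_singleton_iff]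
    decide
  · refine .inr (.inr (.inr (.inr (.inr (.inr (.inl (nonempty_iso_of_adjB e ?_)))))))
    simp only [netGraph, fromEdgeSet_adj, Set.mem_insert_iff, Set.mem_singleton_iff]
    decide
  · refine .inr (.inr (.inr (.inr (.inr (.inr (.inr (nonempty_iso_of_adjB e ?_)))))))
    simp only [woundedGraph, fromEdgeSet_adj, Set.mem_insert_iff, Set.mem_singleton_iff]
    decide

variable {β : Type*} [Fintype β] {S : SimpleGraph β}

lemma nonempty_iso_clawGraph_of_not_oHeavy (hS : S.Connected) (hcard : 3 ≤ Fintype.card β)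
    (hP3 : ¬ Nonempty (S ≃g pathGraph 3)) (h : ¬ OHeavy (boolGraph 5 bipartiteB) S) :
    Nonempty (S ≃g clawGraph) := by
  obtain ⟨f, hf⟩ := exists_embedding_of_not_oHeavy (m := 2) (d := 3) h (by decide) (by simp)
    (by decide)
  rcases exists_of_classified hS hcard f hf classified_bipartite with ⟨p, hp, ⟨e⟩⟩ | ⟨p, hp, -⟩
  · rcases List.mem_pair.1 hp with rfl | rfl
    · exact absurd (nonempty_iso_pathGraph_three e) hP3
    · exact nonempty_iso_clawGraph e
  · cases hp

lemma isOneOfLRWZ_of_not_oHeavy (hS : S.Connected) (hcard : 3 ≤ Fintype.card β)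
    (hP3 : ¬ Nonempty (S ≃g pathGraph 3)) (h₁ : ¬ OHeavy (boolGraph 9 threePathsB) S)
    (h₂ : ¬ OHeavy (boolGraph 9 threeTrianglesB) S)
    (h₃ : ¬ OHeavy (boolGraph 14 completeHubB) S) : IsOneOfLRWZ S := by
  obtain ⟨f, hf⟩ := exists_embedding_of_not_oHeavy (m := 0) (d := 9) h₁ (by simp) (by simp)
    (by simp)
  rcases exists_of_classified hS hcard f hf classified_threePaths with
    ⟨p, hp, ⟨e⟩⟩ | ⟨p, hp, ⟨φ⟩⟩
  · rcases List.mem_cons.1 hp with rfl | hp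
    · exact absurd (nonempty_iso_pathGraph_three e) hP3
    · exact isOneOfLRWZ_of_iso hp e
  · rcases List.mem_cons.1 hp with rfl | hp
    · exact absurd (oHeavy_of_embedding (oHeavy_completeHub (by simp)) φ) h₃
    · exact absurd (oHeavy_of_embedding (oHeavy_threeTriangles (List.mem_cons_of_mem _ hp)) φ) h₂

variable {α : Type*} {R : SimpleGraph α}

lemma isOneOfLRWZ_of_forall_isHamiltonian (hR : Nonempty (R ≃g clawGraph)) (hS : S.Connected)
    (hcard : 3 ≤ Fintype.card β) (hP3 : ¬ Nonempty (S ≃g pathGraph 3))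
    (h : ∀ (V : Type) [Fintype V] [DecidableEq V] (G : SimpleGraph V) [DecidableRel G.Adj],
      TwoConnected G → OHeavy G R → OHeavy G S → G.IsHamiltonian) : IsOneOfLRWZ S := by
  obtain ⟨e₁⟩ := hR
  obtain ⟨e₂⟩ := nonempty_clawGraph_iso
  have φ : edgeGraph clawData ↪g R := e₁.symm.toEmbedding.comp e₂.toEmbedding
  refine isOneOfLRWZ_of_not_oHeavy hS hcard hP3 (fun h' => ?_) (fun h' => ?_) (fun h' => ?_)
  · exact not_isHamiltonian_threePaths (h _ _ twoConnected_threePaths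
      (oHeavy_of_embedding oHeavy_threePaths_claw φ) h')
  · exact not_isHamiltonian_threeTriangles (h _ _ twoConnected_threeTriangles
      (oHeavy_of_embedding (oHeavy_threeTriangles (by simp)) φ) h')
  · exact not_isHamiltonian_completeHub (h _ _ twoConnected_completeHub
      (oHeavy_of_embedding (oHeavy_completeHub (by simp)) φ) h')

end Necessity

end HeavyPairs

/-- Li–Ryjáček–Wang–Zhang: for connected graphs `R, S` of order at least 3, none
isomorphic to `P₃`, every 2-connected `R`-o-heavy and `S`-o-heavy graph is hamiltonian
if and only if, up to symmetry, `R ≅ K_{1,3}` and `S` is one of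
`P₄, P₅, C₃, Z₁, Z₂, B, N, W`. -/
theorem stmt_13 {α β : Type*} [Fintype α] [Fintype β]
    (R : SimpleGraph α) (S : SimpleGraph β)
    (hRconn : R.Connected) (hSconn : S.Connected)
    (hRcard : 3 ≤ Fintype.card α) (hScard : 3 ≤ Fintype.card β)
    (hRP3 : ¬ Nonempty (R ≃g SimpleGraph.pathGraph 3))
    (hSP3 : ¬ Nonempty (S ≃g SimpleGraph.pathGraph 3)) :
    (∀ (V : Type) [Fintype V] [DecidableEq V] (G : SimpleGraph V) [DecidableRel G.Adj],
        TwoConnected G → OHeavy G R → OHeavy G S → G.IsHamiltonian)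
    ↔ ((Nonempty (R ≃g clawGraph) ∧ IsOneOfLRWZ S) ∨
       (Nonempty (S ≃g clawGraph) ∧ IsOneOfLRWZ R)) := by
  constructor
  · intro h
    have hor : ¬ OHeavy (HeavyPairs.boolGraph 5 HeavyPairs.bipartiteB) R ∨
        ¬ OHeavy (HeavyPairs.boolGraph 5 HeavyPairs.bipartiteB) S := by
      by_contra! hno
      exact HeavyPairs.not_isHamiltonian_bipartite
        (h _ _ HeavyPairs.twoConnected_bipartite hno.1 hno.2)
    rcases hor with hR | hS
    · have hR := HeavyPairs.nonempty_iso_clawGraph_of_not_oHeavy hRconn hRcard hRP3 hR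
      exact Or.inl ⟨hR,
        HeavyPairs.isOneOfLRWZ_of_forall_isHamiltonian hR hSconn hScard hSP3 h⟩
    · have hS := HeavyPairs.nonempty_iso_clawGraph_of_not_oHeavy hSconn hScard hSP3 hS
      exact Or.inr ⟨hS, HeavyPairs.isOneOfLRWZ_of_forall_isHamiltonian hS hRconn hRcard hRP3
        fun V _ _ G _ hG h₁ h₂ => h V G hG h₂ h₁⟩
  · rintro (⟨hR, hS⟩ | ⟨hS, hR⟩) V _ _ G _ hG h₁ h₂
    · exact HeavyPairs.isHamiltonian_of_oHeavy hR hS hG h₁ h₂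
    · exact HeavyPairs.isHamiltonian_of_oHeavy hS hR hG h₂ h₁
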